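/- For every even integer d ≥ 4, Q_d^{(2)}(n) is asymptotically equivalent, as n → ∞ through the positive integers, to (1 / (4 (3(d+3))^{1/4} sin(2π/(d+3)))) · n^{−3/4} · exp(2π√n / √(3(d+3))); that is, the ratio of Q_d^{(2)}(n) to this expression tends to 1. -/

import Mathlib

open Filter Real

/-- Q_d^{(a)}(n): the number of partitions of n into parts ≡ a or −a (mod d+3). -/
def QPart (d a n : ℕ) : ℕ :=
  Fintype.card {p : Nat.Partition n //
    ∀ i ∈ p.parts, (i : ZMod (d + 3)) = (a : ZMod (d + 3)) ∨
      (i : ZMod (d + 3)) = -(a : ZMod (d + 3))}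

section PartitionSeries

open Nat.Partition PowerSeries
open scoped PowerSeries.WithPiTopology

theorem powerSeries_card_restricted_eq_prod (s : Finset ℕ) (hs : 0 ∉ s) :
    PowerSeries.mk (fun n ↦ ((restricted n (· ∈ s)).card : ℂ)) =
      ∏ i ∈ s, PowerSeries.mk (fun n ↦ if i ∣ n then (1 : ℂ) else 0) := by
  have h := hasProd_powerSeriesMk_card_restricted ℂ (· ∈ s)
  have h' := hasProd_prod_of_ne_finset_one (s := s.image Nat.pred)
    (f := fun i ↦ if i + 1 ∈ s then ∑' j : ℕ, (X : ℂ⟦X⟧) ^ ((i + 1) * j) else 1)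
    (L := SummationFilter.unconditional ℕ) (by
      intro b hb
      refine if_neg fun hbs ↦ hb (Finset.mem_image.mpr ⟨b + 1, hbs, rfl⟩))
  have hpos : ∀ i ∈ s, i ≠ 0 := fun i hi h0 ↦ hs (h0 ▸ hi)
  rw [h.unique h', Finset.prod_image]
  · refine Finset.prod_congr rfl fun i hi ↦ ?_
    have hi1 : i.pred + 1 = i := Nat.succ_pred_eq_of_ne_zero (hpos i hi)
    rw [hi1, if_pos hi]
    have hsum : Summable fun j : ℕ ↦ (X : ℂ⟦X⟧) ^ (i * j) := by
      simp_rw [pow_mul]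
      exact WithPiTopology.summable_pow_of_constantCoeff_eq_zero (by simp [hpos i hi])
    ext n
    rw [hsum.map_tsum _ (WithPiTopology.continuous_coeff _ _), coeff_mk]
    simp_rw [coeff_X_pow]
    split_ifs with hd
    · obtain ⟨k, rfl⟩ := hd
      rw [tsum_eq_single k]
      · simp
      · intro b hb
        exact if_neg fun h ↦ hb (Nat.eq_of_mul_eq_mul_left (Nat.pos_of_ne_zero (hpos i hi)) h).symm
    · convert tsum_zero with j
      exact if_neg fun h ↦ hd ⟨j, h⟩
  · intro a ha b hb hab
    have := hpos a ha
    have := hpos b hb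
    simp only [Nat.pred_eq_sub_one] at hab
    lia

theorem powerSeries_eval_mul {f g : ℂ⟦X⟧} {q : ℂ}
    (hf : Summable fun n ↦ ‖coeff n f * q ^ n‖) (hg : Summable fun n ↦ ‖coeff n g * q ^ n‖) :
    (Summable fun n ↦ ‖coeff n (f * g) * q ^ n‖) ∧
      ∑' n, coeff n (f * g) * q ^ n = (∑' n, coeff n f * q ^ n) * ∑' n, coeff n g * q ^ n := by
  have key : ∀ n, coeff n (f * g) * q ^ n =
      ∑ kl ∈ Finset.HasAntidiagonal.antidiagonal n,
        (coeff kl.1 f * q ^ kl.1) * (coeff kl.2 g * q ^ kl.2) := by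
    intro n
    rw [coeff_mul, Finset.sum_mul]
    refine Finset.sum_congr rfl fun kl hkl ↦ ?_
    rw [← Finset.HasAntidiagonal.mem_antidiagonal.mp hkl, pow_add]
    ring
  have h1 := summable_norm_sum_mul_antidiagonal_of_summable_norm hf hg
  have h2 := tsum_mul_tsum_eq_tsum_sum_antidiagonal_of_summable_norm hf hg
  refine ⟨h1.congr fun n ↦ by rw [key n], ?_⟩
  rw [h2]
  exact tsum_congr key

theorem powerSeries_eval_dvd {q : ℂ} (hq : ‖q‖ < 1) {i : ℕ} (hi : i ≠ 0) :
    (Summable fun n ↦ ‖coeff n (PowerSeries.mk fun n ↦ if i ∣ n then (1 : ℂ) else 0) * q ^ n‖) ∧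
      ∑' n, coeff n (PowerSeries.mk fun n ↦ if i ∣ n then (1 : ℂ) else 0) * q ^ n =
        (1 - q ^ i)⁻¹ := by
  simp only [coeff_mk]
  refine ⟨?_, ?_⟩
  · refine Summable.of_nonneg_of_le (fun _ ↦ norm_nonneg _) (fun n ↦ ?_)
      (summable_geometric_of_lt_one (norm_nonneg q) hq)
    split_ifs <;> simp
  · have hinj : Function.Injective fun k : ℕ ↦ i * k :=
      fun a b h ↦ Nat.eq_of_mul_eq_mul_left (Nat.pos_of_ne_zero hi) h
    have hq' : ‖q ^ i‖ < 1 := by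
      rw [norm_pow]; exact pow_lt_one₀ (norm_nonneg _) hq hi
    rw [← tsum_geometric_of_norm_lt_one hq', ← hinj.tsum_eq]
    · simp [pow_mul]
    · intro n hn
      by_contra hcon
      refine hn ?_
      have : ¬ i ∣ n := by
        rintro ⟨k, rfl⟩
        exact hcon ⟨k, rfl⟩
      simp [this]

theorem powerSeries_eval_prod_dvd {q : ℂ} (hq : ‖q‖ < 1) (s : Finset ℕ) (hs : 0 ∉ s) :
    (Summable fun n ↦ ‖coeff n (∏ i ∈ s, PowerSeries.mk
      fun n ↦ if i ∣ n then (1 : ℂ) else 0) * q ^ n‖) ∧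
      ∑' n, coeff n (∏ i ∈ s, PowerSeries.mk fun n ↦ if i ∣ n then (1 : ℂ) else 0) * q ^ n =
        ∏ i ∈ s, (1 - q ^ i)⁻¹ := by
  induction s using Finset.induction_on with
  | empty =>
    simp only [Finset.prod_empty, coeff_one]
    refine ⟨summable_of_ne_finset_zero (s := {0}) fun b hb ↦ ?_, ?_⟩
    · simp only [Finset.mem_singleton] at hb
      simp [hb]
    · rw [tsum_eq_single 0] <;> simp +contextual
  | insert a s ha ih =>
    simp only [Finset.mem_insert, not_or] at hs
    have h1 := powerSeries_eval_dvd hq (Ne.symm hs.1)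
    have h2 := ih hs.2
    have h3 := powerSeries_eval_mul h1.1 h2.1
    rw [Finset.prod_insert ha, Finset.prod_insert ha]
    exact ⟨h3.1, by rw [h3.2, h1.2, h2.2]⟩

theorem hasSum_card_restricted {q : ℂ} (hq : ‖q‖ < 1) (s : Finset ℕ) (hs : 0 ∉ s) :
    HasSum (fun n ↦ ((restricted n (· ∈ s)).card : ℂ) * q ^ n) (∏ i ∈ s, (1 - q ^ i)⁻¹) := by
  have h := powerSeries_eval_prod_dvd hq s hs
  rw [← powerSeries_card_restricted_eq_prod s hs] at h
  simp only [coeff_mk] at h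
  rw [← h.2]
  exact h.1.of_norm.hasSum

end PartitionSeries

section JacobiTripleProduct

open Topology

/-- The finite q-Pochhammer symbol `(q; q)_n`. -/
def qPoch (q : ℂ) (n : ℕ) : ℂ := ∏ k ∈ Finset.range n, (1 - q ^ (k + 1))

/-- The Gaussian binomial coefficient, evaluated at `q`. -/
def gaussBinom (q : ℂ) : ℕ → ℕ → ℂ
  | _, 0 => 1
  | 0, _ + 1 => 0
  | n + 1, k + 1 => gaussBinom q n k + q ^ (k + 1) * gaussBinom q n (k + 1)

theorem gaussBinom_zero_right (q : ℂ) (n : ℕ) : gaussBinom q n 0 = 1 := by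
  cases n <;> rfl

theorem gaussBinom_eq_zero_of_lt (q : ℂ) {n k : ℕ} (h : n < k) : gaussBinom q n k = 0 := by
  induction n generalizing k with
  | zero => obtain ⟨k, rfl⟩ := Nat.exists_eq_add_one_of_ne_zero h.ne'; rfl
  | succ n ih =>
    obtain ⟨k, rfl⟩ := Nat.exists_eq_add_one_of_ne_zero (Nat.ne_zero_of_lt h)
    rw [gaussBinom, ih (by lia), ih (by lia)]
    ring

theorem qPoch_succ (q : ℂ) (n : ℕ) : qPoch q (n + 1) = qPoch q n * (1 - q ^ (n + 1)) :=
  Finset.prod_range_succ _ _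

theorem gaussBinom_mul_qPoch (q : ℂ) (n i k : ℕ) (h : i + k = n) :
    gaussBinom q n k * (qPoch q k * qPoch q i) = qPoch q n := by
  induction n generalizing i k with
  | zero =>
    obtain ⟨rfl, rfl⟩ : i = 0 ∧ k = 0 := by lia
    simp [gaussBinom, qPoch]
  | succ n ih =>
    rcases k with _ | k
    · obtain rfl : i = n + 1 := by lia
      simp [gaussBinom_zero_right, qPoch]
    · rcases i with _ | i
      · obtain rfl : k = n := by lia
        have h1 := ih 0 k (by lia)
        rw [gaussBinom, gaussBinom_eq_zero_of_lt q (Nat.lt_succ_self k), qPoch_succ]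
        linear_combination (1 - q ^ (k + 1)) * h1
      · have h1 := ih (i + 1) k (by lia)
        have h2 := ih i (k + 1) (by lia)
        obtain rfl : n = i + 1 + k := by lia
        rw [gaussBinom]
        simp only [qPoch_succ] at h1 h2 ⊢
        linear_combination (1 - q ^ (k + 1)) * h1 + q ^ (k + 1) * (1 - q ^ (i + 1)) * h2

theorem prod_one_add_eq_sum_gaussBinom (p : ℂ) (M : ℕ) (x : ℂ) :
    ∏ k ∈ Finset.range M, (1 + x * p ^ (2 * k + 1)) =
      ∑ j ∈ Finset.range (M + 1), p ^ (j ^ 2) * x ^ j * gaussBinom (p ^ 2) M j := by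
  induction M generalizing x with
  | zero => simp [gaussBinom]
  | succ M ih =>
    have h1 : ∀ k, 1 + x * p ^ (2 * (k + 1) + 1) = 1 + (x * p ^ 2) * p ^ (2 * k + 1) :=
      fun k ↦ by ring
    rw [Finset.prod_range_succ']
    simp_rw [h1]
    rw [ih, Finset.sum_range_succ' _ (M + 1)]
    simp_rw [gaussBinom, mul_add, Finset.sum_add_distrib]
    have h2 : ∑ j ∈ Finset.range (M + 1), p ^ (j ^ 2) * (x * p ^ 2) ^ j * gaussBinom (p ^ 2) M j =
        ∑ j ∈ Finset.range (M + 1), p ^ ((j + 1) ^ 2) * x ^ (j + 1) *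
          ((p ^ 2) ^ (j + 1) * gaussBinom (p ^ 2) M (j + 1)) + 1 := by
      have h3 := Finset.sum_range_succ'
        (fun j ↦ p ^ (j ^ 2) * (x * p ^ 2) ^ j * gaussBinom (p ^ 2) M j) (M + 1)
      rw [Finset.sum_range_succ, gaussBinom_eq_zero_of_lt _ (Nat.lt_succ_self M)] at h3
      simp only [gaussBinom_zero_right] at h3
      rw [mul_zero, add_zero] at h3
      rw [h3]
      congr 1
      · exact Finset.sum_congr rfl fun j _ ↦ by ring
      · simp
    have h4 : (∑ j ∈ Finset.range (M + 1), p ^ (j ^ 2) * (x * p ^ 2) ^ j *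
        gaussBinom (p ^ 2) M j) * (x * p) =
        ∑ j ∈ Finset.range (M + 1), p ^ ((j + 1) ^ 2) * x ^ (j + 1) * gaussBinom (p ^ 2) M j := by
      rw [Finset.sum_mul]
      exact Finset.sum_congr rfl fun j _ ↦ by ring
    have h5 : (2 * 0 + 1) = 1 := rfl
    rw [h5, pow_one, mul_one, h4, h2]
    simp
    ring

theorem prod_triple_eq_sum_gaussBinom {p y : ℂ} (hp : p ≠ 0) (hy : y ≠ 0) (N : ℕ) :
    ∏ k ∈ Finset.range N, ((1 + y * p ^ (2 * k + 1)) * (1 + y⁻¹ * p ^ (2 * k + 1))) =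
      ∑ j ∈ Finset.range (2 * N + 1), p ^ (((j : ℤ) - N) ^ 2) * y ^ ((j : ℤ) - N) *
        gaussBinom (p ^ 2) (2 * N) j := by
  have h := prod_one_add_eq_sum_gaussBinom p (2 * N) (y * (p ^ (2 * N))⁻¹)
  have hsplit : ∏ k ∈ Finset.range (2 * N), (1 + (y * (p ^ (2 * N))⁻¹) * p ^ (2 * k + 1)) =
      y ^ N * (p ^ (N ^ 2))⁻¹ * ∏ k ∈ Finset.range N,
        ((1 + y * p ^ (2 * k + 1)) * (1 + y⁻¹ * p ^ (2 * k + 1))) := by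
    rw [two_mul N, Finset.prod_range_add, Finset.prod_mul_distrib]
    have h1 : ∀ k, 1 + (y * (p ^ (N + N))⁻¹) * p ^ (2 * (N + k) + 1) = 1 + y * p ^ (2 * k + 1) := by
      intro k
      field_simp
      ring
    simp_rw [h1]
    have h2 : ∏ k ∈ Finset.range N, (1 + (y * (p ^ (N + N))⁻¹) * p ^ (2 * k + 1)) =
        ∏ k ∈ Finset.range N, ((y * (p ^ (2 * k + 1))⁻¹) * (1 + y⁻¹ * p ^ (2 * k + 1))) := by
      rw [← Finset.prod_range_reflect]
      refine Finset.prod_congr rfl fun k hk ↦ ?_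
      have hk' := Finset.mem_range.mp hk
      obtain ⟨r, rfl⟩ : ∃ r, N = k + 1 + r := ⟨N - (k + 1), by lia⟩
      have e : k + 1 + r - 1 - k = r := by lia
      rw [e]
      field_simp
      ring
    have h3 : ∏ k ∈ Finset.range N, (y * (p ^ (2 * k + 1))⁻¹) = y ^ N * (p ^ (N ^ 2))⁻¹ := by
      clear h h1 h2
      induction N with
      | zero => simp
      | succ N ih =>
        rw [Finset.prod_range_succ, ih]
        field_simp
        ring
    rw [h2, Finset.prod_mul_distrib, h3]
    ring
  rw [hsplit] at h
  have hne : y ^ N * (p ^ (N ^ 2))⁻¹ ≠ 0 := by positivity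
  apply mul_left_cancel₀ hne
  rw [h, Finset.mul_sum]
  refine Finset.sum_congr rfl fun j _ ↦ ?_
  have e1 : p ^ (((j : ℤ) - N) ^ 2) = p ^ (j ^ 2) * p ^ (N ^ 2) * (p ^ (2 * N * j))⁻¹ := by
    rw [← zpow_natCast p (j ^ 2), ← zpow_natCast p (N ^ 2), ← zpow_natCast p (2 * N * j),
      ← zpow_neg, ← zpow_add₀ hp, ← zpow_add₀ hp]
    congr 1
    push_cast
    ring
  rw [e1, zpow_sub₀ hy, zpow_natCast, zpow_natCast, mul_pow, inv_pow, ← pow_mul]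
  field_simp

theorem one_sub_pow_ne_zero_of_norm_lt_one {q : ℂ} (hq : ‖q‖ < 1) {k : ℕ} (hk : k ≠ 0) :
    1 - q ^ k ≠ 0 := by
  intro h
  have h1 : ‖q ^ k‖ = 1 := by rw [← sub_eq_zero.mp h, norm_one]
  rw [norm_pow] at h1
  exact (pow_lt_one₀ (norm_nonneg _) hq hk).ne h1

theorem qPoch_ne_zero {q : ℂ} (hq : ‖q‖ < 1) (n : ℕ) : qPoch q n ≠ 0 :=
  Finset.prod_ne_zero_iff.mpr fun k _ ↦ one_sub_pow_ne_zero_of_norm_lt_one hq k.succ_ne_zero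

theorem exists_tendsto_qPoch {q : ℂ} (hq : ‖q‖ < 1) :
    ∃ L : ℂ, L ≠ 0 ∧ Tendsto (qPoch q) atTop (𝓝 L) := by
  refine ⟨∏' k, (1 + -q ^ (k + 1)), ?_, ?_⟩
  · refine tprod_one_add_ne_zero_of_summable (fun k ↦ ?_) ?_
    · simpa [← sub_eq_add_neg] using one_sub_pow_ne_zero_of_norm_lt_one hq k.succ_ne_zero
    · simpa using (summable_nat_add_iff 1).mpr (summable_geometric_of_lt_one (norm_nonneg _) hq)
  · simp only [← sub_eq_add_neg]
    exact (ModularForm.multipliable_one_sub_pow hq).hasProd.tendsto_prod_nat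

/-- The Jacobi triple product identity. -/
theorem tendsto_prod_triple {p y : ℂ} (hp : p ≠ 0) (hp1 : ‖p‖ < 1) (hy : y ≠ 0)
    (hs : Summable fun n : ℤ ↦ p ^ (n ^ 2) * y ^ n) :
    Tendsto (fun N ↦ qPoch (p ^ 2) N * ∏ k ∈ Finset.range N,
        ((1 + y * p ^ (2 * k + 1)) * (1 + y⁻¹ * p ^ (2 * k + 1)))) atTop
      (𝓝 (∑' n : ℤ, p ^ (n ^ 2) * y ^ n)) := by
  have hq : ‖p ^ 2‖ < 1 := by
    rw [norm_pow]; exact pow_lt_one₀ (norm_nonneg _) hp1 two_ne_zero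
  obtain ⟨L, hL0, hL⟩ := exists_tendsto_qPoch hq
  obtain ⟨C, hC⟩ := (Metric.isBounded_range_of_tendsto _ hL).exists_norm_le
  obtain ⟨D, hD⟩ := (Metric.isBounded_range_of_tendsto _ (hL.inv₀ hL0)).exists_norm_le
  replace hC : ∀ n, ‖qPoch (p ^ 2) n‖ ≤ C := fun n ↦ hC _ ⟨n, rfl⟩
  replace hD : ∀ n, ‖(qPoch (p ^ 2) n)⁻¹‖ ≤ D := fun n ↦ hD _ ⟨n, rfl⟩
  have hC0 : 0 ≤ C := (norm_nonneg _).trans (hC 0)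
  have hD0 : 0 ≤ D := (norm_nonneg _).trans (hD 0)
  let c : ℕ → ℤ → ℂ := fun N n ↦ if n.natAbs ≤ N then
    qPoch (p ^ 2) N * gaussBinom (p ^ 2) (2 * N) (N + n).toNat else 0
  have hc : ∀ N (n : ℤ), n.natAbs ≤ N → c N n = qPoch (p ^ 2) N * qPoch (p ^ 2) (2 * N) *
      ((qPoch (p ^ 2) (N + n).toNat)⁻¹ * (qPoch (p ^ 2) (N - n).toNat)⁻¹) := by
    intro N n hn
    have h := gaussBinom_mul_qPoch (p ^ 2) (2 * N) (N - n).toNat (N + n).toNat (by lia)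
    have h1 := qPoch_ne_zero hq (N + n).toNat
    have h2 := qPoch_ne_zero hq (N - n).toNat
    simp only [c, if_pos hn, ← h]
    field_simp
  have hsum : ∀ N, qPoch (p ^ 2) N * ∏ k ∈ Finset.range N,
      ((1 + y * p ^ (2 * k + 1)) * (1 + y⁻¹ * p ^ (2 * k + 1))) =
      ∑' n : ℤ, c N n * (p ^ (n ^ 2) * y ^ n) := by
    intro N
    have hinj : Function.Injective fun j : ℕ ↦ (j : ℤ) - N := fun a b h ↦ by
      simpa using h
    rw [prod_triple_eq_sum_gaussBinom hp hy, ← hinj.tsum_eq, tsum_eq_sum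
      (s := Finset.range (2 * N + 1)), Finset.mul_sum]
    · refine Finset.sum_congr rfl fun j hj ↦ ?_
      have hj' := Finset.mem_range.mp hj
      have e1 : ((j : ℤ) - N).natAbs ≤ N := by lia
      have e2 : ((N : ℤ) + (j - N)).toNat = j := by lia
      simp only [c, if_pos e1, e2]
      ring
    · intro j hj
      have hj' : ¬ j < 2 * N + 1 := fun h ↦ hj (Finset.mem_range.mpr h)
      have e1 : ¬ ((j : ℤ) - N).natAbs ≤ N := by lia
      simp [c, e1]
    · intro n hn
      have hn' : n.natAbs ≤ N := by
        by_contra hcon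
        exact hn (by simp [c, hcon])
      exact ⟨(n + N).toNat, by simp only; lia⟩
  simp_rw [hsum]
  refine tendsto_tsum_of_dominated_convergence
    (bound := fun n ↦ C * C * (D * D) * ‖p ^ (n ^ 2) * y ^ n‖) (hs.norm.mul_left _) ?_ ?_
  · intro n
    have hev : (fun N ↦ qPoch (p ^ 2) N * qPoch (p ^ 2) (2 * N) *
        ((qPoch (p ^ 2) ((N : ℤ) + n).toNat)⁻¹ * (qPoch (p ^ 2) ((N : ℤ) - n).toNat)⁻¹)) =ᶠ[atTop]
        fun N ↦ c N n := by
      filter_upwards [eventually_ge_atTop n.natAbs] with N hN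
      exact (hc N n hN).symm
    have t1 : Tendsto (fun N : ℕ ↦ 2 * N) atTop atTop := 
      tendsto_atTop_mono (fun N ↦ show N ≤ 2 * N by lia) tendsto_id
    have t2 : ∀ n : ℤ, Tendsto (fun N : ℕ ↦ ((N : ℤ) + n).toNat) atTop atTop := fun n ↦
      tendsto_atTop.mpr fun b ↦ by
        filter_upwards [eventually_ge_atTop (b + n.natAbs)] with N hN
        lia
    have t3 := ((hL.mul (hL.comp t1)).mul
      (((hL.comp (t2 n)).inv₀ hL0).mul ((hL.comp (t2 (-n))).inv₀ hL0))).congr' hev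
    have e : L * L * (L⁻¹ * L⁻¹) = 1 := by field_simp
    rw [e] at t3
    simpa using t3.mul_const (p ^ (n ^ 2) * y ^ n)
  · refine Eventually.of_forall fun N n ↦ ?_
    rw [norm_mul]
    gcongr
    by_cases hn : n.natAbs ≤ N
    · rw [hc N n hn, norm_mul, norm_mul, norm_mul]
      gcongr <;> apply_assumption
    · simp only [c, if_neg hn, norm_zero]
      positivity

end JacobiTripleProduct

section ThetaAsymptotics

open Topology Complex

/-- The filter of complex numbers approaching `0` tangentially to the right half-plane, in the sense
that `Re (1 / s) → ∞`. -/
noncomputable def reInvAtTop : Filter ℂ := comap (fun s : ℂ ↦ s⁻¹.re) atTop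

theorem tendsto_re_inv_reInvAtTop : Tendsto (fun s : ℂ ↦ s⁻¹.re) reInvAtTop atTop := tendsto_comap

theorem reInvAtTop_le_nhds_zero : reInvAtTop ≤ 𝓝 0 := by
  have h : Tendsto (fun s : ℂ ↦ ‖s⁻¹‖) reInvAtTop atTop :=
    tendsto_atTop_mono (fun s ↦ (le_abs_self _).trans (Complex.abs_re_le_norm _))
      tendsto_re_inv_reInvAtTop
  have h1 := h.inv_tendsto_atTop
  have h2 : Tendsto (fun s : ℂ ↦ ‖s‖) reInvAtTop (𝓝 0) := by
    refine h1.congr fun s ↦ ?_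
    simp
  exact tendsto_zero_iff_norm_tendsto_zero.mpr h2

theorem eventually_re_pos_reInvAtTop : ∀ᶠ s in reInvAtTop, 0 < s.re := by
  filter_upwards [tendsto_re_inv_reInvAtTop.eventually_gt_atTop 0] with s hs
  rw [Complex.inv_re] at hs
  by_contra hcon
  exact absurd hs (not_lt.mpr (div_nonpos_of_nonpos_of_nonneg (not_lt.mp hcon) (normSq_nonneg _)))

theorem tendsto_ofReal_mul_reInvAtTop {c : ℝ} (hc : 0 < c) :
    Tendsto (fun s : ℂ ↦ (c : ℂ) * s) reInvAtTop reInvAtTop := by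
  refine tendsto_comap_iff.mpr ?_
  have h := tendsto_re_inv_reInvAtTop.const_mul_atTop (inv_pos.mpr hc)
  refine h.congr fun s ↦ ?_
  rw [Function.comp_apply, mul_inv, ← ofReal_inv, re_ofReal_mul]

theorem jacobiTheta₂_term_neg_half (β : ℝ) (u : ℂ) (n : ℤ) :
    jacobiTheta₂_term n (-I * u / 2 - β) (I * u) =
      cexp (-π * ((n : ℂ) ^ 2 - n) * u) * cexp (-2 * π * I * n * β) := by
  rw [jacobiTheta₂_term, ← Complex.exp_add]
  congr 1
  linear_combination (-π * n * u + π * n ^ 2 * u) * I_sq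

theorem summable_exp_neg_abs_int : Summable fun n : ℤ ↦ rexp 1 * rexp (-|(n : ℝ)|) := by
  refine Summable.mul_left _ ?_
  have h : Summable fun n : ℕ ↦ rexp (-(n : ℝ)) := Real.summable_exp_neg_nat
  refine Summable.of_nat_of_neg ?_ ?_ <;> simpa using h

theorem tendsto_jacobiTheta₂_neg_half {ι : Type*} {l : Filter ι} {u : ι → ℂ}
    (hu : Tendsto (fun i ↦ (u i).re) l atTop) (β : ℝ) :
    Tendsto (fun i ↦ jacobiTheta₂ (-I * u i / 2 - β) (I * u i)) l
      (𝓝 (1 + cexp (-2 * π * I * β))) := by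
  have hlim : ∑' n : ℤ, (if n = 0 ∨ n = 1 then cexp (-2 * π * I * n * β) else 0) =
      1 + cexp (-2 * π * I * β) := by
    rw [tsum_eq_sum (s := {0, 1})]
    · simp
    · intro b hb
      simp only [Finset.mem_insert, Finset.mem_singleton] at hb
      simp [hb]
  rw [← hlim]
  unfold jacobiTheta₂
  simp_rw [jacobiTheta₂_term_neg_half]
  have hb : ∀ n : ℤ, ‖cexp (-2 * π * I * n * β)‖ = 1 := by
    intro n
    have : (-2 * π * I * n * β : ℂ) = ((-2 * π * n * β : ℝ) : ℂ) * I := by push_cast; ring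
    rw [this, norm_exp_ofReal_mul_I]
  have ha : ∀ (n : ℤ) (u : ℂ), ‖cexp (-π * ((n : ℂ) ^ 2 - n) * u)‖ =
      rexp (-(π * ((n : ℝ) ^ 2 - n)) * u.re) := by
    intro n u
    have : (-π * ((n : ℂ) ^ 2 - n) * u : ℂ) = ((-(π * ((n : ℝ) ^ 2 - n)) : ℝ) : ℂ) * u := by
      push_cast; ring
    rw [this, norm_exp, re_ofReal_mul]
  refine tendsto_tsum_of_dominated_convergence summable_exp_neg_abs_int ?_ ?_
  · intro n
    split_ifs with hn
    · have : (n : ℂ) ^ 2 - n = 0 := by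
        rcases hn with rfl | rfl <;> simp
      simp only [this, mul_zero, zero_mul, Complex.exp_zero, one_mul]
      exact tendsto_const_nhds
    · have hpos : (1 : ℝ) ≤ (n : ℝ) ^ 2 - n := by
        have : (1 : ℤ) ≤ n ^ 2 - n := by
          rcases le_or_gt n (-1) with h | h
          · nlinarith
          · have : 2 ≤ n := by lia
            nlinarith
        exact_mod_cast this
      rw [tendsto_zero_iff_norm_tendsto_zero]
      simp_rw [norm_mul, hb, mul_one, ha]
      refine Real.tendsto_exp_atBot.comp ?_
      exact hu.const_mul_atTop_of_neg (by nlinarith [pi_pos])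
  · filter_upwards [hu.eventually_ge_atTop 1] with i hi n
    rw [norm_mul, hb, mul_one, ha, ← Real.exp_add]
    refine Real.exp_le_exp.mpr ?_
    have h1 : |(n : ℝ)| - 1 ≤ (n : ℝ) ^ 2 - n := by
      have : |n| - 1 ≤ n ^ 2 - n := by
        rcases abs_cases n with h | h <;> nlinarith
      exact_mod_cast this
    have h0 : (0 : ℝ) ≤ (n : ℝ) ^ 2 - n := by
      have : 0 ≤ n ^ 2 - n := by
        rcases le_or_gt n 0 with h | h <;> nlinarith
      exact_mod_cast this
    have h2 : (n : ℝ) ^ 2 - n ≤ π * ((n : ℝ) ^ 2 - n) := by nlinarith [pi_gt_three]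
    nlinarith [mul_nonneg pi_pos.le h0]

/-- Behaviour of the theta function at the cusp `0`, from the functional equation. -/
theorem tendsto_jacobiTheta₂_cusp_zero (β : ℝ) :
    Tendsto (fun s : ℂ ↦ jacobiTheta₂ (1 / 2 - I * β * s) (I * s) * s ^ (1 / 2 : ℂ) *
      cexp (π / (4 * s))) reInvAtTop (𝓝 (2 * Real.cos (π * β))) := by
  have h1 := tendsto_jacobiTheta₂_neg_half tendsto_re_inv_reInvAtTop β
  have h2 : Tendsto (fun s : ℂ ↦ cexp (I * π * β + π * β ^ 2 * s)) reInvAtTop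
      (𝓝 (cexp (I * π * β))) := by
    have : Continuous fun s : ℂ ↦ cexp (I * π * β + π * β ^ 2 * s) := by fun_prop
    simpa using (this.tendsto 0).mono_left reInvAtTop_le_nhds_zero
  have h3 := h2.mul h1
  have e : cexp (I * π * β) * (1 + cexp (-2 * π * I * β)) = 2 * Real.cos (π * β) := by
    rw [mul_add, mul_one, ← Complex.exp_add, ofReal_cos, Complex.two_cos]
    congr 2 <;> push_cast <;> ring
  rw [e] at h3
  refine h3.congr' ?_
  filter_upwards [eventually_re_pos_reInvAtTop] with s hs
  have hs0 : s ≠ 0 := by rintro rfl; simp at hs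
  have hI := I_ne_zero
  rw [jacobiTheta₂_functional_equation (1 / 2 - I * β * s)]
  have e1 : -I * (I * s) = s := by linear_combination (-s) * I_sq
  have e2 : (1 / 2 - I * β * s) / (I * s) = -I * s⁻¹ / 2 - β := by
    field_simp
    linear_combination I_sq
  have e3 : -1 / (I * s) = I * s⁻¹ := by
    field_simp
    linear_combination (-1 : ℂ) * I_sq
  have e4 : -π * I * (1 / 2 - I * β * s) ^ 2 / (I * s) =
      I * π * β + π * β ^ 2 * s + -(π / (4 * s)) := by
    field_simp
    linear_combination (-16 * β ^ 2 * s ^ 2 : ℂ) * I_sq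
  rw [e1, e2, e3, e4, Complex.exp_add _ (-(π / (4 * s))), Complex.exp_neg]
  have hsq : s ^ (1 / 2 : ℂ) ≠ 0 := by simp [cpow_eq_zero_iff, hs0]
  have := Complex.exp_ne_zero (π / (4 * s))
  field_simp

/-- The theta function attached to the residue class `a` modulo `m`. -/
noncomputable def residueTheta (m a : ℕ) (t : ℂ) : ℂ :=
  jacobiTheta₂ (1 / 2 - I * ((1 / 2 - a / m : ℝ) : ℂ) * (((m / (2 * π) : ℝ) : ℂ) * t))
    (I * (((m / (2 * π) : ℝ) : ℂ) * t))

theorem tendsto_residueTheta {m : ℕ} (hm : 0 < m) (a : ℕ) :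
    Tendsto (fun t : ℂ ↦ residueTheta m a t * (((m / (2 * π) : ℝ) : ℂ) * t) ^ (1 / 2 : ℂ) *
      cexp (π ^ 2 / (2 * m * t))) reInvAtTop (𝓝 (2 * Real.sin (π * a / m))) := by
  have hc : (0 : ℝ) < m / (2 * π) := by positivity
  have h := (tendsto_jacobiTheta₂_cusp_zero (1 / 2 - a / m)).comp (tendsto_ofReal_mul_reInvAtTop hc)
  have e : Real.cos (π * (1 / 2 - a / m)) = Real.sin (π * a / m) := by
    rw [← Real.cos_pi_div_two_sub]
    congr 1
    ring
  rw [e] at h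
  refine h.congr fun t ↦ ?_
  simp only [Function.comp_apply, residueTheta]
  congr 2
  have := ofReal_ne_zero.mpr pi_ne_zero
  have : (m : ℂ) ≠ 0 := by exact_mod_cast hm.ne'
  push_cast
  rcases eq_or_ne t 0 with rfl | ht
  · simp
  field_simp
  norm_num

theorem tendsto_prod_residueTheta {m a : ℕ} (hm : 0 < m) (ham : a ≤ m) {t : ℂ} (ht : 0 < t.re) :
    Tendsto (fun N ↦ ∏ k ∈ Finset.range N, ((1 - cexp (-t) ^ (m * (k + 1))) *
      ((1 - cexp (-t) ^ (m * k + a)) * (1 - cexp (-t) ^ (m * k + (m - a)))))) atTop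
      (𝓝 (residueTheta m a t)) := by
  have hπ := ofReal_ne_zero.mpr pi_ne_zero
  have hm0 : (m : ℂ) ≠ 0 := by exact_mod_cast hm.ne'
  have hm' : (0 : ℝ) < m := by exact_mod_cast hm
  set p : ℂ := cexp (-(m * t / 2)) with hp
  set y : ℂ := -cexp ((m / 2 - a) * t) with hy
  have hp1 : ‖p‖ < 1 := by
    rw [hp, norm_exp, Real.exp_lt_one_iff]
    have : -((m : ℂ) * t / 2) = ((-(m / 2) : ℝ) : ℂ) * t := by push_cast; ring
    rw [this, re_ofReal_mul]
    nlinarith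
  have hterm : ∀ n : ℤ, p ^ (n ^ 2) * y ^ n = jacobiTheta₂_term n
      (1 / 2 - I * ((1 / 2 - a / m : ℝ) : ℂ) * (((m / (2 * π) : ℝ) : ℂ) * t))
      (I * (((m / (2 * π) : ℝ) : ℂ) * t)) := by
    intro n
    have hy' : y = cexp (π * I + (m / 2 - a) * t) := by
      rw [Complex.exp_add, Complex.exp_pi_mul_I, hy]; ring
    rw [hp, hy', ← Complex.exp_int_mul, ← Complex.exp_int_mul, ← Complex.exp_add, jacobiTheta₂_term]
    congr 1
    push_cast
    field_simp
    linear_combination (n * t * (m - 2 * a) - n ^ 2 * m * t : ℂ) * I_sq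
  have hpos : 0 < (I * (((m / (2 * π) : ℝ) : ℂ) * t)).im := by
    rw [I_mul_im, re_ofReal_mul]
    positivity
  have hs := (summable_jacobiTheta₂_term_iff
    (1 / 2 - I * ((1 / 2 - a / m : ℝ) : ℂ) * (((m / (2 * π) : ℝ) : ℂ) * t)) _).mpr hpos
  have h := tendsto_prod_triple (Complex.exp_ne_zero _) hp1
    (neg_ne_zero.mpr (Complex.exp_ne_zero ((m / 2 - a) * t))) (hs.congr fun n ↦ (hterm n).symm)
  rw [← hy, tsum_congr hterm] at h
  refine h.congr fun N ↦ ?_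
  rw [qPoch, ← Finset.prod_mul_distrib]
  refine Finset.prod_congr rfl fun k _ ↦ ?_
  have e1 : (p ^ 2) ^ (k + 1) = cexp (-t) ^ (m * (k + 1)) := by
    rw [hp, ← Complex.exp_nat_mul, ← Complex.exp_nat_mul, ← Complex.exp_nat_mul]
    congr 1; push_cast; ring
  have e2 : y * p ^ (2 * k + 1) = -cexp (-t) ^ (m * k + a) := by
    rw [hp, hy, ← Complex.exp_nat_mul, ← Complex.exp_nat_mul, neg_mul, ← Complex.exp_add]
    congr 2; push_cast; ring
  have e3 : y⁻¹ * p ^ (2 * k + 1) = -cexp (-t) ^ (m * k + (m - a)) := by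
    rw [hp, hy, ← Complex.exp_nat_mul, ← Complex.exp_nat_mul, inv_neg, ← Complex.exp_neg, neg_mul,
      ← Complex.exp_add]
    congr 2; push_cast [Nat.cast_sub ham]; ring
  rw [e1, e2, e3]
  ring

end ThetaAsymptotics

section GeneratingFunction

open Topology Complex

/-- The positive integers congruent to `a` or `-a` modulo `m`, up to `m * N`. -/
def residuePairs (m a N : ℕ) : Finset ℕ :=
  (Finset.range N).image (fun k ↦ m * k + a) ∪ (Finset.range N).image (fun k ↦ m * k + (m - a))

@[to_additive]
theorem prod_residuePairs {M : Type*} [CommMonoid M] {m a : ℕ} (ha : 0 < a) (ham : 2 * a < m)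
    (N : ℕ) (f : ℕ → M) :
    ∏ i ∈ residuePairs m a N, f i =
      ∏ k ∈ Finset.range N, (f (m * k + a) * f (m * k + (m - a))) := by
  rw [residuePairs, Finset.prod_union, Finset.prod_image, Finset.prod_image,
    Finset.prod_mul_distrib]
  · intro x _ y _ h
    exact Nat.eq_of_mul_eq_mul_left (by lia : 0 < m) (by simpa using h)
  · intro x _ y _ h
    exact Nat.eq_of_mul_eq_mul_left (by lia : 0 < m) (by simpa using h)
  · rw [Finset.disjoint_left]
    intro x hx hy
    obtain ⟨k, -, rfl⟩ := Finset.mem_image.mp hx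
    obtain ⟨l, -, hl⟩ := Finset.mem_image.mp hy
    have h := congrArg (· % m) hl
    simp only [Nat.mul_add_mod] at h
    rw [Nat.mod_eq_of_lt (by lia), Nat.mod_eq_of_lt (by lia)] at h
    lia

theorem mem_residuePairs_bounds {m a N i : ℕ} (ha : 0 < a) (ham : 2 * a < m)
    (hi : i ∈ residuePairs m a N) : 0 < i ∧ i ≤ m * N := by
  simp only [residuePairs, Finset.mem_union, Finset.mem_image, Finset.mem_range] at hi
  have key : ∀ k < N, m * k + m ≤ m * N := fun k hk ↦ by
    rw [← Nat.mul_succ]; exact Nat.mul_le_mul_left _ hk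
  rcases hi with ⟨k, hk, rfl⟩ | ⟨k, hk, rfl⟩ <;> have := key k hk <;> constructor <;> lia

theorem natCast_eq_or_eq_neg_of_mem_residuePairs {m a N i : ℕ} (ham : a ≤ m)
    (hi : i ∈ residuePairs m a N) : (i : ZMod m) = a ∨ (i : ZMod m) = -a := by
  simp only [residuePairs, Finset.mem_union, Finset.mem_image, Finset.mem_range] at hi
  rcases hi with ⟨k, hk, rfl⟩ | ⟨k, hk, rfl⟩
  · left; simp
  · right; simp [Nat.cast_sub ham]

theorem mem_residuePairs_of_natCast {m a N i : ℕ} (ha : 0 < a) (ham : 2 * a < m) (hi : i < m * N)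
    (h : (i : ZMod m) = a ∨ (i : ZMod m) = -a) : i ∈ residuePairs m a N := by
  have hk : i / m < N := Nat.div_lt_of_lt_mul hi
  have hdm := Nat.div_add_mod i m
  simp only [residuePairs, Finset.mem_union, Finset.mem_image, Finset.mem_range]
  rcases h with h | h
  · left
    rw [ZMod.natCast_eq_natCast_iff', Nat.mod_eq_of_lt (by lia : a < m)] at h
    exact ⟨i / m, hk, by rw [← h, hdm]⟩
  · right
    have h' : (i : ZMod m) = ((m - a : ℕ) : ZMod m) := by
      rw [h, Nat.cast_sub (by lia)]; simp
    rw [ZMod.natCast_eq_natCast_iff', Nat.mod_eq_of_lt (by lia : m - a < m)] at h'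
    exact ⟨i / m, hk, by rw [← h', hdm]⟩

theorem QPart_eq_card_filter (d a n : ℕ) :
    QPart d a n = (Finset.univ.filter fun p : Nat.Partition n ↦
      ∀ i ∈ p.parts, (i : ZMod (d + 3)) = (a : ZMod (d + 3)) ∨
        (i : ZMod (d + 3)) = -(a : ZMod (d + 3))).card :=
  Fintype.card_subtype _

theorem card_restricted_le_QPart {d a : ℕ} (ham : 2 * a < d + 3) (N n : ℕ) :
    (Nat.Partition.restricted n (· ∈ residuePairs (d + 3) a N)).card ≤ QPart d a n := by
  rw [QPart_eq_card_filter]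
  refine Finset.card_le_card fun p hp ↦ ?_
  simp only [Nat.Partition.restricted, Finset.mem_filter, Finset.mem_univ, true_and] at hp ⊢
  exact fun i hi ↦ natCast_eq_or_eq_neg_of_mem_residuePairs (by lia) (hp i hi)

theorem card_restricted_eq_QPart {d a : ℕ} (ha : 0 < a) (ham : 2 * a < d + 3) {N n : ℕ}
    (hn : n < (d + 3) * N) :
    (Nat.Partition.restricted n (· ∈ residuePairs (d + 3) a N)).card = QPart d a n := by
  refine le_antisymm (card_restricted_le_QPart ham N n) ?_
  rw [QPart_eq_card_filter]
  refine Finset.card_le_card fun p hp ↦ ?_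
  simp only [Nat.Partition.restricted, Finset.mem_filter, Finset.mem_univ, true_and] at hp ⊢
  exact fun i hi ↦ mem_residuePairs_of_natCast ha ham
    ((Nat.Partition.le_of_mem_parts hi).trans_lt hn) (hp i hi)

theorem exists_prod_residuePairs_le {m a : ℕ} (ha : 0 < a) (ham : 2 * a < m) {r : ℝ} (hr0 : 0 ≤ r)
    (hr1 : r < 1) : ∃ B : ℝ, ∀ N, ‖∏ i ∈ residuePairs m a N, (1 - (r : ℂ) ^ i)⁻¹‖ ≤ B := by
  have hnr : ‖(r : ℂ)‖ < 1 := by rwa [norm_real, Real.norm_of_nonneg hr0]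
  obtain ⟨L, hL, hlim⟩ := exists_tendsto_qPoch hnr
  have hinv := (hlim.inv₀ hL).norm
  obtain ⟨B, hB⟩ := hinv.bddAbove_range
  refine ⟨B, fun N ↦ le_trans ?_ (hB ⟨m * N, rfl⟩)⟩
  have hq : (qPoch r (m * N))⁻¹ = ∏ i ∈ Finset.Icc 1 (m * N), (1 - (r : ℂ) ^ i)⁻¹ := by
    rw [qPoch, ← Finset.prod_inv_distrib, Finset.range_eq_Ico,
      Finset.prod_Ico_add' (fun k ↦ (1 - (r : ℂ) ^ k)⁻¹) 0 (m * N) 1]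
    rfl
  simp only [hq, norm_prod]
  have hsub : residuePairs m a N ⊆ Finset.Icc 1 (m * N) := fun i hi ↦ by
    have := mem_residuePairs_bounds ha ham hi
    exact Finset.mem_Icc.mpr ⟨this.1, this.2⟩
  rw [← Finset.prod_sdiff hsub]
  refine le_mul_of_one_le_left (Finset.prod_nonneg fun i _ ↦ norm_nonneg _) ?_
  rw [← Finset.prod_const_one (s := Finset.Icc 1 (m * N) \ residuePairs m a N)]
  refine Finset.prod_le_prod (fun i _ ↦ zero_le_one) ?_
  · intro i hi
    have hi1 : i ≠ 0 := by have := (Finset.mem_Icc.mp (Finset.mem_sdiff.mp hi).1).1; lia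
    have h1 : 0 < 1 - r ^ i := sub_pos.mpr (pow_lt_one₀ hr0 hr1 hi1)
    rw [norm_inv, ← ofReal_pow, ← ofReal_one, ← ofReal_sub, norm_real, Real.norm_of_nonneg h1.le]
    exact (one_le_inv₀ h1).mpr (by linarith [pow_nonneg hr0 i])

theorem summable_QPart_mul_pow {d a : ℕ} (ha : 0 < a) (ham : 2 * a < d + 3) {r : ℝ} (hr0 : 0 ≤ r)
    (hr1 : r < 1) : Summable fun n ↦ (QPart d a n : ℝ) * r ^ n := by
  obtain ⟨B, hB⟩ := exists_prod_residuePairs_le ha ham hr0 hr1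
  refine summable_of_sum_range_le (c := B) (fun n ↦ by positivity) fun M ↦ ?_
  have hnr : ‖(r : ℂ)‖ < 1 := by rwa [norm_real, Real.norm_of_nonneg hr0]
  have h0 : 0 ∉ residuePairs (d + 3) a M := fun h ↦
    lt_irrefl _ (mem_residuePairs_bounds ha ham h).1
  have h := reCLM.hasSum (hasSum_card_restricted hnr _ h0)
  have hterm : ∀ n, reCLM (((Nat.Partition.restricted n
      (· ∈ residuePairs (d + 3) a M)).card : ℂ) * (r : ℂ) ^ n) =
      ((Nat.Partition.restricted n (· ∈ residuePairs (d + 3) a M)).card : ℝ) * r ^ n := by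
    intro n
    rw [reCLM_apply, ← ofReal_pow, ← ofReal_natCast, ← ofReal_mul, ofReal_re]
  simp only [hterm] at h
  calc ∑ n ∈ Finset.range M, (QPart d a n : ℝ) * r ^ n
      = ∑ n ∈ Finset.range M, ((Nat.Partition.restricted n
          (· ∈ residuePairs (d + 3) a M)).card : ℝ) * r ^ n := by
        refine Finset.sum_congr rfl fun n hn ↦ ?_
        rw [card_restricted_eq_QPart ha ham]
        have := Finset.mem_range.mp hn
        nlinarith
    _ ≤ _ := sum_le_hasSum _ (fun n _ ↦ by positivity) h
    _ ≤ B := (Complex.re_le_norm _).trans (hB M)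

/-- The generating function of `QPart d a`. -/
noncomputable def QGen (d a : ℕ) (q : ℂ) : ℂ := ∑' n, (QPart d a n : ℂ) * q ^ n

theorem summable_norm_QPart_mul_pow {d a : ℕ} (ha : 0 < a) (ham : 2 * a < d + 3) {q : ℂ}
    (hq : ‖q‖ < 1) : Summable fun n ↦ ‖(QPart d a n : ℂ) * q ^ n‖ := by
  simpa [norm_mul, norm_pow] using summable_QPart_mul_pow ha ham (norm_nonneg q) hq

theorem tendsto_prod_QGen {d a : ℕ} (ha : 0 < a) (ham : 2 * a < d + 3) {q : ℂ} (hq : ‖q‖ < 1) :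
    Tendsto (fun N ↦ ∏ i ∈ residuePairs (d + 3) a N, (1 - q ^ i)⁻¹) atTop (𝓝 (QGen d a q)) := by
  have h0 : ∀ N, 0 ∉ residuePairs (d + 3) a N := fun N h ↦
    lt_irrefl _ (mem_residuePairs_bounds ha ham h).1
  have h : ∀ N, ∏ i ∈ residuePairs (d + 3) a N, (1 - q ^ i)⁻¹ =
      ∑' n, ((Nat.Partition.restricted n (· ∈ residuePairs (d + 3) a N)).card : ℂ) * q ^ n :=
    fun N ↦ (hasSum_card_restricted hq _ (h0 N)).tsum_eq.symm
  simp_rw [h]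
  refine tendsto_tsum_of_dominated_convergence (summable_norm_QPart_mul_pow ha ham hq)
    (fun n ↦ ?_) (Eventually.of_forall fun N n ↦ ?_)
  · refine tendsto_const_nhds.congr' ?_
    filter_upwards [eventually_gt_atTop n] with N hN
    rw [card_restricted_eq_QPart ha ham]
    nlinarith
  · rw [norm_mul, norm_mul, Complex.norm_natCast, Complex.norm_natCast]
    gcongr
    exact card_restricted_le_QPart ham N n

theorem tendsto_qPoch_residueTheta {t : ℂ} (ht : 0 < t.re) :
    Tendsto (qPoch (cexp (-t))) atTop (𝓝 (residueTheta 3 1 t)) := by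
  have hq : ‖cexp (-t)‖ < 1 := by
    rw [norm_exp, neg_re]; exact Real.exp_lt_one_iff.mpr (by linarith)
  obtain ⟨L, -, hL⟩ := exists_tendsto_qPoch hq
  have h3 := hL.comp (tendsto_id.const_mul_atTop' (by norm_num : 0 < 3))
  have h := tendsto_prod_residueTheta (m := 3) (a := 1) (by norm_num) (by norm_num) ht
  have heq : ∀ N, qPoch (cexp (-t)) (3 * N) = ∏ k ∈ Finset.range N,
      ((1 - cexp (-t) ^ (3 * (k + 1))) * ((1 - cexp (-t) ^ (3 * k + 1)) *
        (1 - cexp (-t) ^ (3 * k + (3 - 1))))) := by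
    intro N
    induction N with
    | zero => simp [qPoch]
    | succ N ih =>
      rw [Finset.prod_range_succ, ← ih, show 3 * (N + 1) = 3 * N + 1 + 1 + 1 by ring, qPoch_succ,
        qPoch_succ, qPoch_succ]
      ring
  rw [← tendsto_nhds_unique (h3.congr heq) h]
  exact hL

theorem QGen_mul_residueTheta {d a : ℕ} (ha : 0 < a) (ham : 2 * a < d + 3) {t : ℂ}
    (ht : 0 < t.re) :
    QGen d a (cexp (-t)) * residueTheta (d + 3) a t = residueTheta 3 1 ((d + 3 : ℕ) * t) := by
  have hq : ‖cexp (-t)‖ < 1 := by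
    rw [norm_exp, neg_re]; exact Real.exp_lt_one_iff.mpr (by linarith)
  have h1 := tendsto_prod_QGen ha ham hq
  have h2 := tendsto_prod_residueTheta (m := d + 3) (a := a) (by lia) (by lia) ht
  have ht' : 0 < (((d + 3 : ℕ) : ℂ) * t).re := by
    rw [← ofReal_natCast, re_ofReal_mul]; positivity
  refine tendsto_nhds_unique ((h1.mul h2).congr fun N ↦ ?_) (tendsto_qPoch_residueTheta ht')
  rw [prod_residuePairs ha ham, ← Finset.prod_mul_distrib, qPoch]
  refine Finset.prod_congr rfl fun k _ ↦ ?_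
  have e1 := one_sub_pow_ne_zero_of_norm_lt_one hq (k := (d + 3) * k + a) (by lia)
  have e2 := one_sub_pow_ne_zero_of_norm_lt_one hq (k := (d + 3) * k + (d + 3 - a)) (by lia)
  have e3 : cexp (-(((d + 3 : ℕ) : ℂ) * t)) = cexp (-t) ^ (d + 3) := by
    rw [← Complex.exp_nat_mul]; ring_nf
  rw [e3, ← pow_mul]
  field_simp

end GeneratingFunction

section CuspAsymptotics

open Topology Complex

theorem ofReal_mul_cpow_half {r : ℝ} (hr : 0 < r) {z : ℂ} (hz : z ≠ 0) :
    ((r : ℂ) * z) ^ (1 / 2 : ℂ) = (√r : ℝ) * z ^ (1 / 2 : ℂ) := by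
  have hr' : (r : ℂ) ≠ 0 := ofReal_ne_zero.mpr hr.ne'
  rw [cpow_def_of_ne_zero (mul_ne_zero hr' hz), cpow_def_of_ne_zero hz,
    Complex.log_ofReal_mul hr hz, add_mul, Complex.exp_add, Real.sqrt_eq_rpow,
    ofReal_cpow hr.le, cpow_def_of_ne_zero hr', ofReal_log hr.le]
  push_cast
  rfl

theorem tendsto_QGen {d a : ℕ} (ha : 0 < a) (ham : 2 * a < d + 3) :
    Tendsto (fun t ↦ QGen d a (cexp (-t)) * cexp (-((π ^ 2 / (3 * (d + 3)) : ℝ) / t)))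
      reInvAtTop (𝓝 ((1 / (2 * Real.sin (π * a / (d + 3))) : ℝ) : ℂ)) := by
  have hm : (0 : ℝ) < (d + 3 : ℕ) := by positivity
  have hsin : 0 < Real.sin (π * a / (d + 3 : ℕ)) := by
    have ha' : (0 : ℝ) < a := by exact_mod_cast ha
    have ham' : (a : ℝ) < (d + 3 : ℕ) := by exact_mod_cast (by lia : a < d + 3)
    refine Real.sin_pos_of_pos_of_lt_pi (by positivity) ?_
    rw [div_lt_iff₀ hm]
    exact mul_lt_mul_of_pos_left ham' Real.pi_pos
  have hA := (tendsto_residueTheta (m := 3) (by norm_num) 1).comp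
    (tendsto_ofReal_mul_reInvAtTop hm)
  have hB := tendsto_residueTheta (m := d + 3) (by lia) a
  have hlim : (2 : ℂ) * Real.sin (π * a / (d + 3 : ℕ)) ≠ 0 :=
    mul_ne_zero two_ne_zero (ofReal_ne_zero.mpr hsin.ne')
  have hAB := (hA.div hB hlim).div_const ((√3 : ℝ) : ℂ)
  have h3 : ((√3 : ℝ) : ℂ) ≠ 0 := by simp
  have hval : (2 : ℂ) * Real.sin (π * (1 : ℕ) / (3 : ℕ)) /
      (2 * Real.sin (π * a / (d + 3 : ℕ))) / (√3 : ℝ) =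
      ((1 / (2 * Real.sin (π * a / (d + 3))) : ℝ) : ℂ) := by
    have e : Real.sin (π * (1 : ℕ) / (3 : ℕ)) = √3 / 2 := by
      rw [← Real.sin_pi_div_three]; norm_num
    rw [e]
    push_cast at hlim ⊢
    field_simp
  rw [hval] at hAB
  refine hAB.congr' ?_
  have hBne := hB.eventually_ne hlim
  filter_upwards [eventually_re_pos_reInvAtTop, hBne] with t ht hBt
  have ht0 : t ≠ 0 := fun h ↦ by simp [h] at ht
  have hx : (((((d + 3 : ℕ) : ℝ) / (2 * π) : ℝ) : ℂ) * t) ≠ 0 :=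
    mul_ne_zero (ofReal_ne_zero.mpr (by positivity)) ht0
  have hcpow : ((((3 : ℕ) / (2 * π) : ℝ) : ℂ) * (((d + 3 : ℕ) : ℝ) * t)) ^ (1 / 2 : ℂ) =
      (√3 : ℝ) * ((((d + 3 : ℕ) : ℝ) / (2 * π) : ℝ) * t) ^ (1 / 2 : ℂ) := by
    rw [← ofReal_mul_cpow_half (by norm_num) hx]
    congr 1
    push_cast
    ring
  have hexp : cexp (π ^ 2 / (2 * (3 : ℕ) * (((d + 3 : ℕ) : ℝ) * t))) =
      cexp (-((π ^ 2 / (3 * (d + 3)) : ℝ) / t)) * cexp (π ^ 2 / (2 * (d + 3 : ℕ) * t)) := by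
    rw [← Complex.exp_add]
    congr 1
    have : (d : ℂ) + 3 ≠ 0 := by exact_mod_cast hm.ne'
    push_cast
    field_simp
    ring
  simp only [Function.comp_apply, Pi.div_apply]
  rw [hcpow, hexp, ofReal_natCast, ← QGen_mul_residueTheta ha ham ht]
  simp only [ne_eq, mul_eq_zero, not_or] at hBt
  obtain ⟨⟨h1, h2⟩, h4⟩ := hBt
  generalize ((((d + 3 : ℕ) : ℝ) / (2 * π) : ℝ) * t : ℂ) ^ (1 / 2 : ℂ) = w at h2 ⊢
  field_simp

end CuspAsymptotics

section MinorArc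

open Topology Complex

theorem one_sub_norm_mul_exp_le_norm_one_sub {w : ℂ} (hw : ‖w‖ ≤ 1) :
    (1 - ‖w‖) * rexp ((‖w‖ - w.re) / 4) ≤ ‖1 - w‖ := by
  have hs0 : 0 ≤ ‖w‖ - w.re := sub_nonneg.mpr (Complex.re_le_norm w)
  have hs2 : ‖w‖ - w.re ≤ 2 := by linarith [(abs_le.mp (Complex.abs_re_le_norm w)).1]
  have hsq : ‖1 - w‖ ^ 2 = (1 - ‖w‖) ^ 2 + 2 * (‖w‖ - w.re) := by
    rw [Complex.sq_norm, Complex.normSq_apply]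
    have h := Complex.sq_norm w
    rw [Complex.normSq_apply] at h
    simp only [sub_re, one_re, sub_im, one_im]
    linear_combination -h
  set s := ‖w‖ - w.re
  have hexp : rexp (s / 4) ^ 2 ≤ 1 + 2 * s := by
    rw [← Real.exp_nat_mul, show ((2 : ℕ) : ℝ) * (s / 4) = s / 2 by push_cast; ring]
    have h := Real.abs_exp_sub_one_sub_id_le (x := s / 2) (by rw [abs_le]; constructor <;> linarith)
    have := (abs_le.mp h).2
    nlinarith
  refine le_of_sq_le_sq ?_ (norm_nonneg _)
  rw [hsq, mul_pow]
  have hn := norm_nonneg w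
  calc (1 - ‖w‖) ^ 2 * rexp (s / 4) ^ 2 ≤ (1 - ‖w‖) ^ 2 * (1 + 2 * s) := by gcongr
    _ ≤ _ := by
      have h1 : (1 - ‖w‖) ^ 2 ≤ 1 := by nlinarith
      nlinarith

theorem exists_le_one_sub_cos {b m : ℕ} (hm : 0 < m) (hbm : b.Coprime m) :
    ∃ ε : ℝ, 0 < ε ∧ ε ≤ 1 ∧ ∀ τ θ : ℝ, 0 ≤ τ → τ ≤ |θ| → |θ| ≤ π →
      ε ≤ 1 - Real.cos (b * θ) ∨ ε * (m * τ) ^ 2 ≤ 1 - Real.cos (m * θ) ∨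
        ε ≤ 1 - Real.cos (m * θ) := by
  have hm' : (0 : ℝ) < m := by exact_mod_cast hm
  have hK : IsCompact {θ : ℝ | π / m ≤ |θ| ∧ |θ| ≤ π} := by
    refine (isCompact_closedBall (0 : ℝ) π).of_isClosed_subset ?_ ?_
    · exact (isClosed_le continuous_const continuous_abs).inter
        (isClosed_le continuous_abs continuous_const)
    · exact fun θ hθ ↦ by simpa using hθ.2
  have hne : {θ : ℝ | π / m ≤ |θ| ∧ |θ| ≤ π}.Nonempty := by
    refine ⟨π, ?_, ?_⟩ <;> rw [abs_of_pos Real.pi_pos]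
    exact div_le_self Real.pi_pos.le (by exact_mod_cast hm)
  obtain ⟨θ₀, hθ₀, hmin⟩ := hK.exists_isMinOn hne
    (f := fun θ ↦ (1 - Real.cos (b * θ)) + (1 - Real.cos (m * θ))) (by fun_prop)
  have hpos : 0 < (1 - Real.cos (b * θ₀)) + (1 - Real.cos (m * θ₀)) := by
    have h1 := Real.cos_le_one (b * θ₀)
    have h2 := Real.cos_le_one (m * θ₀)
    by_contra hcon
    obtain ⟨k, hk⟩ := (Real.cos_eq_one_iff _).mp (by linarith : Real.cos (b * θ₀) = 1)
    obtain ⟨l, hl⟩ := (Real.cos_eq_one_iff _).mp (by linarith : Real.cos (m * θ₀) = 1)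
    have hbez : ((b : ℝ) * b.gcdA m + m * b.gcdB m) = 1 := by
      have := Nat.gcd_eq_gcd_ab b m
      rw [hbm.gcd_eq_one] at this
      exact_mod_cast this.symm
    have hθ : ((k * b.gcdA m + l * b.gcdB m : ℤ) : ℝ) * (2 * π) = θ₀ := by
      push_cast
      linear_combination (b.gcdA m : ℝ) * hk + (b.gcdB m : ℝ) * hl + θ₀ * hbez
    have h0 : θ₀ ≠ 0 := fun h ↦ by
      have := hθ₀.1
      rw [h, abs_zero] at this
      exact absurd this (not_le.mpr (by positivity))
    have hz : (k * b.gcdA m + l * b.gcdB m : ℤ) ≠ 0 := fun h ↦ by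
      rw [h] at hθ; exact h0 (by rw [← hθ]; simp)
    have habs : (1 : ℝ) ≤ |((k * b.gcdA m + l * b.gcdB m : ℤ) : ℝ)| := by
      exact_mod_cast Int.one_le_abs hz
    have h3 := hθ₀.2
    rw [← hθ, abs_mul, abs_of_pos Real.two_pi_pos] at h3
    nlinarith [Real.pi_pos]
  set η := (1 - Real.cos (b * θ₀)) + (1 - Real.cos (m * θ₀))
  refine ⟨min (min (η / 2) (2 / π ^ 2)) 1, by positivity, min_le_right _ _,
    fun τ θ hτ hτθ hθ ↦ ?_⟩
  have hη : min (min (η / 2) (2 / π ^ 2)) 1 ≤ η / 2 := (min_le_left _ _).trans (min_le_left _ _)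
  have hε : min (min (η / 2) (2 / π ^ 2)) 1 ≤ 2 / π ^ 2 :=
    (min_le_left _ _).trans (min_le_right _ _)
  rcases le_total (π / m) |θ| with h | h
  · have : η ≤ (1 - Real.cos (b * θ)) + (1 - Real.cos (m * θ)) := hmin ⟨h, hθ⟩
    by_cases h1 : η / 2 ≤ 1 - Real.cos (b * θ)
    · left; linarith
    · right; right; linarith
  · right; left
    have h1 : |m * θ| ≤ π := by
      rw [abs_mul, abs_of_pos hm']
      rwa [le_div_iff₀' hm'] at h
    have h2 := Real.cos_le_one_sub_mul_cos_sq h1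
    calc _ ≤ 2 / π ^ 2 * (m * |θ|) ^ 2 := by gcongr
      _ = 2 / π ^ 2 * (m * θ) ^ 2 := by rw [mul_pow, mul_pow, sq_abs]
      _ ≤ _ := by linarith

/-- The sum of `q ^ i` over all positive `i` congruent to `a` or `-a` modulo `m`. -/
noncomputable def residueGeom (m a : ℕ) (q : ℂ) : ℂ := (q ^ a + q ^ (m - a)) / (1 - q ^ m)

theorem tendsto_sum_residueGeom {m a : ℕ} (ha : 0 < a) (ham : 2 * a < m) {q : ℂ} (hq : ‖q‖ < 1) :
    Tendsto (fun N ↦ ∑ i ∈ residuePairs m a N, q ^ i) atTop (𝓝 (residueGeom m a q)) := by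
  have hqm : ‖q ^ m‖ < 1 := by
    rw [norm_pow]; exact pow_lt_one₀ (norm_nonneg q) hq (by lia)
  have h := ((hasSum_geometric_of_norm_lt_one hqm).mul_left (q ^ a + q ^ (m - a))).tendsto_sum_nat
  rw [residueGeom, div_eq_mul_inv]
  refine h.congr fun N ↦ ?_
  rw [sum_residuePairs ha ham]
  refine Finset.sum_congr rfl fun k _ ↦ ?_
  ring

theorem norm_QGen_le {d a : ℕ} (ha : 0 < a) (ham : 2 * a < d + 3) {q : ℂ} (hq : ‖q‖ < 1) :
    ‖QGen d a q‖ ≤ ‖QGen d a ‖q‖‖ *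
      rexp (-((residueGeom (d + 3) a ‖q‖).re - (residueGeom (d + 3) a q).re) / 4) := by
  have hq' : ‖((‖q‖ : ℝ) : ℂ)‖ < 1 := by rwa [norm_real, norm_norm]
  have h1 := (tendsto_prod_QGen ha ham hq).norm
  have h2 := (tendsto_prod_QGen ha ham hq').norm
  have h3 := (continuous_re.tendsto _).comp (tendsto_sum_residueGeom ha ham hq)
  have h4 := (continuous_re.tendsto _).comp (tendsto_sum_residueGeom ha ham hq')
  have h5 := (Real.continuous_exp.tendsto _).comp ((h4.sub h3).neg.div_const 4)
  refine le_of_tendsto_of_tendsto' h1 (h2.mul h5) fun N ↦ ?_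
  simp only [Function.comp_apply, re_sum, ← Finset.sum_sub_distrib, ← Finset.sum_neg_distrib,
    Finset.sum_div, Real.exp_sum, norm_prod, ← Finset.prod_mul_distrib]
  refine Finset.prod_le_prod (fun i _ ↦ norm_nonneg _) fun i hi ↦ ?_
  have hi0 : i ≠ 0 := (mem_residuePairs_bounds ha ham hi).1.ne'
  have hr : ‖q‖ ^ i < 1 := pow_lt_one₀ (norm_nonneg q) hq hi0
  have key := one_sub_norm_mul_exp_le_norm_one_sub (w := q ^ i) (by rw [norm_pow]; exact hr.le)
  rw [norm_pow] at key
  rw [← ofReal_pow, ofReal_re, norm_inv, norm_inv, ← ofReal_one, ← ofReal_sub, norm_real,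
    Real.norm_of_nonneg (sub_nonneg.mpr hr.le), neg_div, Real.exp_neg, ← mul_inv]
  exact inv_anti₀ (mul_pos (sub_pos.mpr hr) (Real.exp_pos _)) (by simpa using key)

theorem normSq_one_sub_exp_pow (τ θ : ℝ) (k : ℕ) :
    ‖1 - cexp (-(τ + θ * I)) ^ k‖ ^ 2 =
      (1 - rexp (-τ) ^ k) ^ 2 + 2 * rexp (-τ) ^ k * (1 - Real.cos (k * θ)) := by
  rw [← Complex.exp_nat_mul, ← Real.exp_nat_mul,
    show (k : ℂ) * -(τ + θ * I) = ((k * -τ : ℝ) : ℂ) + ((-(k * θ) : ℝ) : ℂ) * I by push_cast; ring,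
    Complex.exp_add_mul_I, ← ofReal_exp, ← ofReal_cos, ← ofReal_sin, Real.cos_neg, Real.sin_neg,
    show ∀ e c s : ℝ, (1 : ℂ) - e * (c + (-s : ℝ) * I) = (1 - e * c : ℝ) + (e * s : ℝ) * I by
      intros; push_cast; ring, Complex.sq_norm, Complex.normSq_add_mul_I]
  linear_combination rexp (k * -τ) ^ 2 * Real.sin_sq_add_cos_sq (k * θ)

theorem normSq_one_add_exp_pow (τ θ : ℝ) (k : ℕ) :
    ‖1 + cexp (-(τ + θ * I)) ^ k‖ ^ 2 =
      (1 + rexp (-τ) ^ k) ^ 2 - 2 * rexp (-τ) ^ k * (1 - Real.cos (k * θ)) := by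
  rw [← Complex.exp_nat_mul, ← Real.exp_nat_mul,
    show (k : ℂ) * -(τ + θ * I) = ((k * -τ : ℝ) : ℂ) + ((-(k * θ) : ℝ) : ℂ) * I by push_cast; ring,
    Complex.exp_add_mul_I, ← ofReal_exp, ← ofReal_cos, ← ofReal_sin, Real.cos_neg, Real.sin_neg,
    show ∀ e c s : ℝ, (1 : ℂ) + e * (c + (-s : ℝ) * I) = (1 + e * c : ℝ) + (-e * s : ℝ) * I by
      intros; push_cast; ring, Complex.sq_norm, Complex.normSq_add_mul_I]
  linear_combination rexp (k * -τ) ^ 2 * Real.sin_sq_add_cos_sq (k * θ)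

theorem norm_exp_neg_add_mul_I (τ θ : ℝ) : ‖cexp (-(τ + θ * I))‖ = rexp (-τ) := by
  simp [norm_exp]

theorem residueGeom_ratio_bound {x y cm cb ε : ℝ} (hx : 1 / 2 ≤ x) (hx1 : x < 1) (hy : 1 / 2 ≤ y)
    (hy1 : y ≤ 1) (hcm : cm ≤ 1) (hcb : cb ≤ 1) (hε0 : 0 < ε) (hε1 : ε ≤ 1)
    (h : ε ≤ 1 - cb ∨ ε * (1 - x) ^ 2 ≤ 1 - cm) :
    ((1 + y) ^ 2 - 2 * y * (1 - cb)) * (1 - x) ^ 2 ≤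
      (1 - ε / 8) ^ 2 * ((1 + y) ^ 2 * ((1 - x) ^ 2 + 2 * x * (1 - cm))) := by
  have hc : 1 - ε / 4 ≤ (1 - ε / 8) ^ 2 := by nlinarith
  have hε4 : 0 ≤ 1 - ε / 4 := by linarith
  have hcb' : 0 ≤ 1 - cb := by linarith
  have hcm' : 0 ≤ 1 - cm := by linarith
  have hV : 0 ≤ 2 * x * (1 - cm) := by positivity
  refine le_trans ?_ (mul_le_mul_of_nonneg_right hc (by positivity))
  rcases h with h | h
  · have h0 : ε ≤ 2 * y * (1 - cb) := by nlinarith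
    have h1 : (1 + y) ^ 2 - 2 * y * (1 - cb) ≤ (1 - ε / 4) * (1 + y) ^ 2 := by
      have : (1 + y) ^ 2 ≤ 4 := by nlinarith
      nlinarith
    calc _ ≤ ((1 - ε / 4) * (1 + y) ^ 2) * (1 - x) ^ 2 := by gcongr
      _ ≤ ((1 - ε / 4) * (1 + y) ^ 2) * ((1 - x) ^ 2 + 2 * x * (1 - cm)) := by
        gcongr
        linarith
      _ = _ := by ring
  · have h0 : ε * (1 - x) ^ 2 ≤ 2 * x * (1 - cm) := by nlinarith
    have h1 : (1 - x) ^ 2 ≤ (1 - ε / 4) * ((1 - x) ^ 2 + 2 * x * (1 - cm)) := by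
      have h2 : 1 ≤ (1 - ε / 4) * (1 + ε) := by nlinarith
      calc (1 - x) ^ 2 ≤ ((1 - ε / 4) * (1 + ε)) * (1 - x) ^ 2 :=
            le_mul_of_one_le_left (sq_nonneg _) h2
        _ = (1 - ε / 4) * ((1 - x) ^ 2 + ε * (1 - x) ^ 2) := by ring
        _ ≤ _ := by gcongr
    calc _ ≤ (1 + y) ^ 2 * (1 - x) ^ 2 := by
          gcongr
          have : 0 ≤ 2 * y * (1 - cb) := by positivity
          linarith
      _ ≤ (1 + y) ^ 2 * ((1 - ε / 4) * ((1 - x) ^ 2 + 2 * x * (1 - cm))) := by gcongr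
      _ = _ := by ring

theorem exists_le_residueGeom_sub {m a : ℕ} (ha : 0 < a) (ham : 2 * a < m)
    (hco : (m - 2 * a).Coprime m) :
    ∃ δ : ℝ, 0 < δ ∧ ∀ τ θ : ℝ, 0 < τ → m * τ ≤ 1 / 2 → τ ≤ |θ| → |θ| ≤ π →
      δ / τ ≤ (residueGeom m a (rexp (-τ))).re - (residueGeom m a (cexp (-(τ + θ * I)))).re := by
  have hm : (0 : ℝ) < m := by exact_mod_cast (by lia : 0 < m)
  obtain ⟨ε, hε0, hε1, hε⟩ := exists_le_one_sub_cos (by lia) hco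
  refine ⟨ε / (16 * m), by positivity, fun τ θ hτ hmτ hτθ hθ ↦ ?_⟩
  set q := cexp (-(τ + θ * I)) with hq
  set r := rexp (-τ) with hr
  have hr0 : 0 < r := Real.exp_pos _
  have hr1 : r < 1 := Real.exp_lt_one_iff.mpr (by linarith)
  have hrm : r ^ m = rexp (-(m * τ)) := by rw [hr, ← Real.exp_nat_mul]; ring_nf
  have hrm2 : 1 - m * τ ≤ r ^ m := by
    rw [hrm]; linarith [Real.add_one_le_exp (-(m * τ))]
  have hrm1 : r ^ m < 1 := pow_lt_one₀ hr0.le hr1 (by lia)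
  have hrb : 1 / 2 ≤ r ^ (m - 2 * a) := le_trans (by linarith)
    (pow_le_pow_of_le_one hr0.le hr1.le (Nat.sub_le m (2 * a)))
  have hrb1 : r ^ (m - 2 * a) ≤ 1 := pow_le_one₀ hr0.le hr1.le
  have hra : 1 / 2 ≤ r ^ a := le_trans (by linarith)
    (pow_le_pow_of_le_one hr0.le hr1.le (by lia : a ≤ m))
  have hfac : ∀ z : ℂ, z ^ a + z ^ (m - a) = z ^ a * (1 + z ^ (m - 2 * a)) := fun z ↦ by
    rw [mul_add, ← pow_add, show a + (m - 2 * a) = m - a by lia, mul_one]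
  have hh : (residueGeom m a r).re = r ^ a * (1 + r ^ (m - 2 * a)) / (1 - r ^ m) := by
    rw [residueGeom, hfac]; norm_cast
  have hg : ‖residueGeom m a q‖ = r ^ a * ‖1 + q ^ (m - 2 * a)‖ / ‖1 - q ^ m‖ := by
    rw [residueGeom, hfac, norm_div, norm_mul, norm_pow, norm_exp_neg_add_mul_I]
  have hu : 0 < 1 - r ^ m := by linarith
  have hN := normSq_one_sub_exp_pow τ θ m
  have hP := normSq_one_add_exp_pow τ θ (m - 2 * a)
  rw [← hq, ← hr] at hN hP
  have hcm := Real.cos_le_one (m * θ)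
  have hcb := Real.cos_le_one ((m - 2 * a : ℕ) * θ)
  have hnum : 0 < ‖1 - q ^ m‖ := by
    refine norm_pos_iff.mpr (one_sub_pow_ne_zero_of_norm_lt_one ?_ (by lia))
    rwa [norm_exp_neg_add_mul_I]
  have hgh : ‖residueGeom m a q‖ ≤ (1 - ε / 8) * (residueGeom m a r).re := by
    have hrat : (‖1 + q ^ (m - 2 * a)‖ * (1 - r ^ m)) ^ 2 ≤
        ((1 - ε / 8) * ((1 + r ^ (m - 2 * a)) * ‖1 - q ^ m‖)) ^ 2 := by
      rw [mul_pow, mul_pow, mul_pow, hN, hP]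
      refine residueGeom_ratio_bound (by linarith) hrm1 hrb hrb1 hcm hcb hε0 hε1 ?_
      rcases hε τ θ hτ.le hτθ hθ with h | h | h
      · exact .inl h
      · exact .inr (le_trans (by gcongr; linarith) h)
      · exact .inr (le_trans (mul_le_of_le_one_right hε0.le (by nlinarith)) h)
    have h8 : 0 ≤ 1 - ε / 8 := by linarith
    have hrat' := le_of_sq_le_sq hrat (by positivity)
    rw [hg, hh, div_le_iff₀ hnum]
    have : (1 - ε / 8) * (r ^ a * (1 + r ^ (m - 2 * a)) / (1 - r ^ m)) * ‖1 - q ^ m‖ =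
      r ^ a * ((1 - ε / 8) * ((1 + r ^ (m - 2 * a)) * ‖1 - q ^ m‖)) / (1 - r ^ m) := by ring
    rw [this, le_div_iff₀ hu, mul_assoc]
    gcongr
  have hhlow : 1 / (2 * (m * τ)) ≤ (residueGeom m a r).re := by
    rw [hh, div_le_div_iff₀ (by positivity) hu]
    have h1 : 1 / 2 ≤ r ^ a * (1 + r ^ (m - 2 * a)) := by nlinarith
    have h2 : 0 < m * τ := by positivity
    nlinarith
  have hre := Complex.re_le_norm (residueGeom m a q)
  calc ε / (16 * m) / τ = ε / 8 * (1 / (2 * (m * τ))) := by field_simp; norm_num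
    _ ≤ ε / 8 * (residueGeom m a r).re := by gcongr
    _ ≤ _ := by linarith

theorem tendsto_ofReal_nhdsGT_reInvAtTop :
    Tendsto (fun τ : ℝ ↦ (τ : ℂ)) (𝓝[>] 0) reInvAtTop := by
  refine tendsto_comap_iff.mpr (tendsto_inv_nhdsGT_zero.congr fun τ ↦ ?_)
  rw [Function.comp_apply, ← ofReal_inv, ofReal_re]

theorem exists_norm_QGen_minorArc_le {d a : ℕ} (ha : 0 < a) (ham : 2 * a < d + 3)
    (hco : (d + 3 - 2 * a).Coprime (d + 3)) :
    ∃ δ C : ℝ, 0 < δ ∧ ∀ᶠ τ : ℝ in 𝓝[>] 0, ∀ θ : ℝ, τ ≤ |θ| → |θ| ≤ π →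
      ‖QGen d a (cexp (-(τ + θ * I)))‖ ≤ C * rexp ((π ^ 2 / (3 * (d + 3)) - δ) / τ) := by
  obtain ⟨δ, hδ, hS⟩ := exists_le_residueGeom_sub ha ham hco
  have hlim := ((tendsto_QGen ha ham).comp tendsto_ofReal_nhdsGT_reInvAtTop).norm
  obtain ⟨C, hC⟩ := hlim.isBoundedUnder_le
  refine ⟨δ / 4, C, by positivity, ?_⟩
  have hm : (0 : ℝ) < (d + 3 : ℕ) := by positivity
  have hsmall : ∀ᶠ τ : ℝ in 𝓝[>] 0, τ < 1 / (2 * (d + 3 : ℕ)) :=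
    nhdsWithin_le_nhds (eventually_lt_nhds (by positivity))
  filter_upwards [hC, hsmall, self_mem_nhdsWithin] with τ hCτ hτ' (hτ : 0 < τ) θ hτθ hθ
  have hmτ : ((d + 3 : ℕ) : ℝ) * τ ≤ 1 / 2 := by
    rw [lt_div_iff₀ (by positivity)] at hτ'
    linarith
  have hq : ‖cexp (-(τ + θ * I))‖ < 1 := by
    rw [norm_exp_neg_add_mul_I]; exact Real.exp_lt_one_iff.mpr (by linarith)
  have h1 := norm_QGen_le ha ham hq
  rw [norm_exp_neg_add_mul_I] at h1
  have h2 := hS τ θ hτ hmτ hτθ hθ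
  replace hCτ : ‖QGen d a (cexp (-τ)) * cexp (-((π ^ 2 / (3 * (d + 3)) : ℝ) / τ))‖ ≤ C := hCτ
  rw [norm_mul, norm_exp, ← ofReal_div, ← ofReal_neg, ← ofReal_neg, ← ofReal_exp, ofReal_re] at hCτ
  have h3 : ‖QGen d a (rexp (-τ))‖ ≤ C * rexp (π ^ 2 / (3 * (d + 3)) / τ) := by
    rwa [← div_le_iff₀ (Real.exp_pos _), div_eq_mul_inv, ← Real.exp_neg]
  calc _ ≤ _ := h1
    _ ≤ (C * rexp (π ^ 2 / (3 * (d + 3)) / τ)) * rexp (-(δ / τ) / 4) := by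
      refine mul_le_mul h3 (by gcongr) (Real.exp_pos _).le ((norm_nonneg _).trans h3)
    _ = _ := by rw [mul_assoc, ← Real.exp_add]; ring_nf

end MinorArc

section CircleMethod

open Topology Complex MeasureTheory

theorem le_re_inv_add_mul_I {τ y : ℝ} (hτ : 0 < τ) (hy : |y| ≤ 1) :
    (2 * τ)⁻¹ ≤ ((τ * (1 + y * I) : ℂ)⁻¹).re := by
  have h1 : (τ * (1 + y * I) : ℂ) = (τ : ℝ) + (τ * y : ℝ) * I := by push_cast; ring
  have hy2 : y ^ 2 ≤ 1 := (sq_le_one_iff_abs_le_one y).mpr hy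
  rw [h1, Complex.inv_re, Complex.normSq_add_mul_I]
  simp only [add_re, ofReal_re, mul_re, I_re, mul_zero, ofReal_im, I_im, mul_one, sub_self,
    add_zero]
  rw [inv_eq_one_div, div_le_div_iff₀ (by positivity) (by positivity)]
  nlinarith [mul_le_mul_of_nonneg_left hy2 (sq_nonneg τ)]

theorem norm_exp_neg_sq_div_le {x y : ℝ} (hy : |y| ≤ 1) :
    ‖cexp (-(x ^ 2 / (1 + y * I)))‖ ≤ rexp (-(1 / 2) * x ^ 2) := by
  have h := le_re_inv_add_mul_I one_pos hy
  rw [ofReal_one, one_mul, mul_one] at h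
  rw [norm_exp, Real.exp_le_exp, div_eq_mul_inv, ← ofReal_pow, neg_re, re_ofReal_mul]
  nlinarith [mul_le_mul_of_nonneg_left h (sq_nonneg x)]

theorem exp_saddle {A N x : ℝ} (hA : 0 < A) (hN : 0 < N) :
    cexp ((N ^ 2 / A : ℝ) * ((A / N : ℝ) * (1 + (x / √N : ℝ) * I)) - 2 * N) =
      cexp (-(A / ((A / N : ℝ) * (1 + (x / √N : ℝ) * I)))) *
        cexp (-(x ^ 2 / (1 + (x / √N : ℝ) * I))) := by
  have hs : (x : ℂ) ^ 2 = N * ((x / √N : ℝ) : ℂ) ^ 2 := by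
    rw [← ofReal_pow, ← ofReal_pow, ← ofReal_mul, div_pow, Real.sq_sqrt hN.le,
      mul_div_cancel₀ _ hN.ne']
  rw [hs]
  generalize (x / √N : ℝ) = y
  have h1 : (1 + y * I : ℂ) ≠ 0 := fun h ↦ by
    have := congrArg re h
    simp at this
  have hA' : (A : ℂ) ≠ 0 := ofReal_ne_zero.mpr hA.ne'
  have hN' : (N : ℂ) ≠ 0 := ofReal_ne_zero.mpr hN.ne'
  rw [← Complex.exp_add]
  congr 1
  push_cast
  field_simp
  linear_combination (y : ℂ) ^ 2 * I_sq

theorem tendsto_majorArc {F : ℂ → ℂ} {A : ℝ} {K : ℂ} (hA : 0 < A)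
    (hcont : ∀ τ : ℝ, 0 < τ → Continuous fun θ : ℝ ↦ F (τ + θ * I))
    (hF : Tendsto (fun t ↦ F t * cexp (-(A / t))) reInvAtTop (𝓝 K)) :
    Tendsto (fun N : ℝ ↦ ((√N * N / A : ℝ) : ℂ) * ∫ θ in -(A / N)..(A / N),
      F ((A / N : ℝ) + θ * I) * cexp ((N ^ 2 / A : ℝ) * ((A / N : ℝ) + θ * I) - 2 * N))
      atTop (𝓝 (√π * K)) := by
  set g : ℝ → ℝ → ℂ := fun N θ ↦
    F ((A / N : ℝ) + θ * I) * cexp ((N ^ 2 / A : ℝ) * ((A / N : ℝ) + θ * I) - 2 * N)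
  set Φ : ℂ → ℂ := fun t ↦ F t * cexp (-(A / t))
  have hgc : ∀ N, 0 < N → Continuous (g N) := fun N hN ↦
    (hcont (A / N) (by positivity)).mul (by fun_prop)
  have hg : ∀ N x : ℝ, 0 < N → g N (A / N / √N * x) =
      Φ ((A / N : ℝ) * (1 + (x / √N : ℝ) * I)) * cexp (-(x ^ 2 / (1 + (x / √N : ℝ) * I))) := by
    intro N x hN
    have ht : ((A / N : ℝ) : ℂ) + (A / N / √N * x : ℝ) * I =
        (A / N : ℝ) * (1 + (x / √N : ℝ) * I) := by push_cast; ring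
    simp only [g, Φ]
    rw [ht, exp_saddle hA hN, mul_assoc]
  have hintegral : ∀ N : ℝ, 0 < N →
      ((√N * N / A : ℝ) : ℂ) * ∫ θ in -(A / N)..(A / N), g N θ =
        ∫ x, (Set.Ioc (-√N) √N).indicator (fun x ↦ g N (A / N / √N * x)) x := by
    intro N hN
    have hs : 0 < √N := Real.sqrt_pos.mpr hN
    have hc : A / N / √N ≠ 0 := by positivity
    rw [integral_indicator measurableSet_Ioc, ← intervalIntegral.integral_of_le (by linarith),
      intervalIntegral.integral_comp_mul_left _ hc, mul_neg, div_mul_cancel₀ _ hs.ne', real_smul]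
    congr 2
    field_simp
  have hgauss : ∫ x : ℝ, K * (rexp (-1 * x ^ 2) : ℂ) = √π * K := by
    rw [integral_const_mul, integral_complex_ofReal, integral_gaussian, div_one, mul_comm]
  rw [← hgauss]
  have hbdd : ∀ᶠ t in reInvAtTop, ‖Φ t‖ ≤ ‖K‖ + 1 :=
    (hF.norm.eventually_lt_const (lt_add_one ‖K‖)).mono fun t ht ↦ ht.le
  rw [reInvAtTop, eventually_comap] at hbdd
  obtain ⟨R, hR⟩ := eventually_atTop.mp hbdd
  have htend : Tendsto (fun N : ℝ ↦ (2 * (A / N))⁻¹) atTop atTop := by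
    have : Tendsto (fun N : ℝ ↦ (2 * A)⁻¹ * N) atTop atTop :=
      tendsto_id.const_mul_atTop (by positivity)
    refine this.congr fun N ↦ ?_
    rw [← mul_div_assoc, inv_div, div_eq_inv_mul]
  have hy : ∀ N x : ℝ, 0 < N → x ∈ Set.Ioc (-√N) √N → |x / √N| ≤ 1 := by
    intro N x hN hx
    rw [abs_div, abs_of_pos (Real.sqrt_pos.mpr hN), div_le_one (Real.sqrt_pos.mpr hN)]
    exact abs_le.mpr ⟨hx.1.le, hx.2⟩
  have hmain : Tendsto (fun N : ℝ ↦
      ∫ x, (Set.Ioc (-√N) √N).indicator (fun x ↦ g N (A / N / √N * x)) x) atTop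
      (𝓝 (∫ x : ℝ, K * (rexp (-1 * x ^ 2) : ℂ))) := by
    refine tendsto_integral_filter_of_dominated_convergence
      (fun x ↦ (‖K‖ + 1) * rexp (-(1 / 2) * x ^ 2)) ?_ ?_ ?_ ?_
    · filter_upwards [eventually_gt_atTop 0] with N hN
      exact (((hgc N hN).comp (continuous_const_mul _)).aestronglyMeasurable).indicator
        measurableSet_Ioc
    · filter_upwards [eventually_gt_atTop 0, htend.eventually_ge_atTop R] with N hN hNR
      refine Eventually.of_forall fun x ↦ ?_
      by_cases hx : x ∈ Set.Ioc (-√N) √N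
      · rw [Set.indicator_of_mem hx, hg N x hN, norm_mul]
        have hyx := hy N x hN hx
        have hτ : 0 < A / N := by positivity
        exact mul_le_mul (hR _ (hNR.trans (le_re_inv_add_mul_I hτ hyx)) _ rfl)
          (norm_exp_neg_sq_div_le hyx) (norm_nonneg _) (by positivity)
      · rw [Set.indicator_of_notMem hx, norm_zero]
        positivity
    · exact (integrable_exp_neg_mul_sq (by norm_num)).const_mul _
    · refine Eventually.of_forall fun x ↦ ?_
      have hmem : ∀ᶠ N : ℝ in atTop, x ∈ Set.Ioc (-√N) √N := by
        filter_upwards [Real.tendsto_sqrt_atTop.eventually_gt_atTop |x|] with N hN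
        have := abs_lt.mp hN
        exact ⟨this.1, this.2.le⟩
      have hyt : Tendsto (fun N : ℝ ↦ x / √N) atTop (𝓝 0) :=
        Real.tendsto_sqrt_atTop.const_div_atTop x
      have hden : Tendsto (fun N : ℝ ↦ (1 + (x / √N : ℝ) * I : ℂ)) atTop (𝓝 1) := by
        have : Tendsto (fun N : ℝ ↦ (1 + (x / √N : ℝ) * I : ℂ)) atTop (𝓝 (1 + (0 : ℝ) * I)) :=
          (((continuous_ofReal.tendsto _).comp hyt).mul_const I).const_add 1
        simpa using this
      have hexp : Tendsto (fun N : ℝ ↦ cexp (-(x ^ 2 / (1 + (x / √N : ℝ) * I)))) atTop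
          (𝓝 (rexp (-1 * x ^ 2) : ℂ)) := by
        have h := (Complex.continuous_exp.tendsto _).comp
          ((tendsto_const_nhds (x := (x : ℂ) ^ 2)).div hden one_ne_zero).neg
        rw [div_one] at h
        rw [neg_one_mul, ofReal_exp, ofReal_neg, ofReal_pow]
        exact h
      have harg : Tendsto (fun N : ℝ ↦ ((A / N : ℝ) * (1 + (x / √N : ℝ) * I) : ℂ)) atTop
          reInvAtTop := by
        refine tendsto_comap_iff.mpr (tendsto_atTop_mono' _ ?_ htend)
        filter_upwards [hmem, eventually_gt_atTop 0] with N hx hN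
        exact le_re_inv_add_mul_I (by positivity) (hy N x hN hx)
      refine ((hF.comp harg).mul hexp).congr' ?_
      filter_upwards [hmem, eventually_gt_atTop 0] with N hx hN
      rw [Set.indicator_of_mem hx, hg N x hN]
      rfl
  refine hmain.congr' ?_
  filter_upwards [eventually_gt_atTop 0] with N hN
  exact (hintegral N hN).symm

theorem tendsto_circle_integral {F : ℂ → ℂ} {A δ C : ℝ} {K : ℂ} (hA : 0 < A) (hδ : 0 < δ)
    (hcont : ∀ τ : ℝ, 0 < τ → Continuous fun θ : ℝ ↦ F (τ + θ * I))
    (hF : Tendsto (fun t ↦ F t * cexp (-(A / t))) reInvAtTop (𝓝 K))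
    (hminor : ∀ᶠ τ : ℝ in 𝓝[>] 0, ∀ θ : ℝ, τ ≤ |θ| → |θ| ≤ π →
      ‖F (τ + θ * I)‖ ≤ C * rexp ((A - δ) / τ)) :
    Tendsto (fun N : ℝ ↦ ((√N * N / A : ℝ) : ℂ) * ∫ θ in -π..π,
      F ((A / N : ℝ) + θ * I) * cexp ((N ^ 2 / A : ℝ) * ((A / N : ℝ) + θ * I) - 2 * N))
      atTop (𝓝 (√π * K)) := by
  have hmajor := tendsto_majorArc hA hcont hF
  have hτ0 : Tendsto (fun N : ℝ ↦ A / N) atTop (𝓝[>] 0) := by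
    refine tendsto_nhdsWithin_iff.mpr ⟨tendsto_id.const_div_atTop A, ?_⟩
    filter_upwards [eventually_gt_atTop 0] with N hN
    exact div_pos hA hN
  have hsmall : ∀ᶠ N : ℝ in atTop, A / N < π :=
    (tendsto_id.const_div_atTop A).eventually_lt_const Real.pi_pos
  have hzero : Tendsto (fun N : ℝ ↦ (2 * π * C / A) * (N ^ (3 / 2 : ℝ) * rexp (-(δ / A) * N)))
      atTop (𝓝 0) := by
    simpa using (tendsto_rpow_mul_exp_neg_mul_atTop_nhds_zero (3 / 2) (δ / A)
      (by positivity)).const_mul (2 * π * C / A)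
  rw [← sub_add_cancel (√π * K : ℂ) (√π * K), sub_self]
  refine ((squeeze_zero_norm' ?_ hzero).add hmajor).congr fun N ↦ sub_add_cancel _ _
  filter_upwards [eventually_gt_atTop 0, hsmall, hτ0.eventually hminor] with N hN hNπ hNm
  set τ := A / N with hτ
  have hτpos : 0 < τ := div_pos hA hN
  set g : ℝ → ℂ := fun θ ↦ F ((τ : ℝ) + θ * I) * cexp ((N ^ 2 / A : ℝ) * ((τ : ℝ) + θ * I) - 2 * N)
    with hg
  have hgc : Continuous g := (hcont τ hτpos).mul (by fun_prop)
  have hgi : ∀ u v, IntervalIntegrable g volume u v := fun u v ↦ hgc.intervalIntegrable u v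
  have hsplit : (∫ θ in -π..π, g θ) - ∫ θ in -τ..τ, g θ =
      (∫ θ in -π..-τ, g θ) + ∫ θ in τ..π, g θ := by
    rw [← intervalIntegral.integral_add_adjacent_intervals (hgi (-π) (-τ)) (hgi (-τ) π),
      ← intervalIntegral.integral_add_adjacent_intervals (hgi (-τ) τ) (hgi τ π)]
    ring
  have hb : ∀ θ : ℝ, τ ≤ |θ| → |θ| ≤ π → ‖g θ‖ ≤ C * rexp (-(δ / A) * N) := by
    intro θ h1 h2
    have h3 : ‖cexp ((N ^ 2 / A : ℝ) * ((τ : ℝ) + θ * I) - 2 * N)‖ = rexp (-N) := by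
      rw [norm_exp]
      congr 1
      have : ((N ^ 2 / A : ℝ) * ((τ : ℝ) + θ * I) - 2 * N : ℂ) =
          ((N ^ 2 / A * τ - 2 * N : ℝ) : ℂ) + ((N ^ 2 / A * θ : ℝ) : ℂ) * I := by push_cast; ring
      rw [this, hτ]
      simp only [add_re, ofReal_re, mul_re, I_re, mul_zero, ofReal_im, I_im, mul_one, sub_self,
        add_zero]
      field_simp
      ring
    rw [hg, norm_mul, h3]
    calc _ ≤ C * rexp ((A - δ) / τ) * rexp (-N) := by gcongr; exact hNm θ h1 h2
      _ = _ := by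
        rw [mul_assoc, ← Real.exp_add, hτ]
        congr 2
        field_simp
        ring
  have hC : 0 ≤ C * rexp (-(δ / A) * N) :=
    (norm_nonneg _).trans (hb π (by rw [abs_of_pos Real.pi_pos]; exact hNπ.le)
      (abs_of_pos Real.pi_pos).le)
  have hl : ‖∫ θ in -π..-τ, g θ‖ ≤ C * rexp (-(δ / A) * N) * π := by
    refine (intervalIntegral.norm_integral_le_of_norm_le_const (C := C * rexp (-(δ / A) * N))
      fun θ hθ ↦ ?_).trans ?_
    · rw [Set.uIoc_of_le (by linarith)] at hθ
      have : |θ| = -θ := abs_of_nonpos (by linarith [hθ.2])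
      exact hb θ (by linarith [hθ.2]) (by linarith [hθ.1])
    · gcongr
      rw [abs_of_nonneg (by linarith)]
      linarith
  have hr : ‖∫ θ in τ..π, g θ‖ ≤ C * rexp (-(δ / A) * N) * π := by
    refine (intervalIntegral.norm_integral_le_of_norm_le_const (C := C * rexp (-(δ / A) * N))
      fun θ hθ ↦ ?_).trans ?_
    · rw [Set.uIoc_of_le hNπ.le] at hθ
      have : |θ| = θ := abs_of_nonneg (by linarith [hθ.1])
      exact hb θ (by linarith [hθ.1]) (by linarith [hθ.2])
    · gcongr
      rw [abs_of_nonneg (by linarith)]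
      linarith
  have hpow : √N * N = N ^ (3 / 2 : ℝ) := by
    rw [Real.sqrt_eq_rpow, ← Real.rpow_add_one hN.ne']
    norm_num
  rw [← mul_sub, hsplit, norm_mul, norm_real, Real.norm_of_nonneg (by positivity), hpow]
  calc _ ≤ N ^ (3 / 2 : ℝ) / A *
        (C * rexp (-(δ / A) * N) * π + C * rexp (-(δ / A) * N) * π) := by
        gcongr
        exact (norm_add_le _ _).trans (add_le_add hl hr)
    _ = _ := by ring

end CircleMethod

section Coefficients

open Topology Complex MeasureTheory

theorem integral_exp_int_mul_add_mul_I (j : ℤ) (τ : ℝ) :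
    ∫ θ in -π..π, cexp (j * (τ + θ * I)) = if j = 0 then 2 * (π : ℂ) else 0 := by
  split_ifs with hj
  · simp only [hj, Int.cast_zero, zero_mul, Complex.exp_zero, intervalIntegral.integral_const]
    rw [real_smul]
    push_cast
    ring
  · have hjI : (j * I : ℂ) ≠ 0 := mul_ne_zero (Int.cast_ne_zero.mpr hj) I_ne_zero
    have h : ∀ θ : ℝ, cexp (j * (τ + θ * I)) = cexp (j * τ) * cexp (j * I * θ) := fun θ ↦ by
      rw [← Complex.exp_add]; ring_nf
    simp_rw [h]
    rw [intervalIntegral.integral_const_mul, integral_exp_mul_complex hjI]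
    have h2 : cexp (j * I * π) = cexp (j * I * (-π : ℝ)) := by
      rw [Complex.exp_eq_exp_iff_exists_int]
      exact ⟨j, by push_cast; ring⟩
    rw [h2, sub_self, zero_div, mul_zero]

theorem continuous_QGen_exp {d a : ℕ} (ha : 0 < a) (ham : 2 * a < d + 3) {τ : ℝ} (hτ : 0 < τ) :
    Continuous fun θ : ℝ ↦ QGen d a (cexp (-(τ + θ * I))) := by
  have hr1 : rexp (-τ) < 1 := Real.exp_lt_one_iff.mpr (by linarith)
  refine continuous_tsum (fun n ↦ by fun_prop)
    (summable_QPart_mul_pow ha ham (Real.exp_pos _).le hr1) fun n θ ↦ ?_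
  rw [norm_mul, norm_pow, norm_exp_neg_add_mul_I, Complex.norm_natCast]

theorem integral_QGen_mul_exp {d a : ℕ} (ha : 0 < a) (ham : 2 * a < d + 3) {τ : ℝ} (hτ : 0 < τ)
    (n : ℕ) :
    ∫ θ in -π..π, QGen d a (cexp (-(τ + θ * I))) * cexp (n * (τ + θ * I)) =
      2 * π * QPart d a n := by
  have hr1 : rexp (-τ) < 1 := Real.exp_lt_one_iff.mpr (by linarith)
  have hsum := (summable_QPart_mul_pow ha ham (Real.exp_pos _).le hr1).mul_right (rexp (n * τ))
  have hterm : ∀ (k : ℕ) (θ : ℝ),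
      (QPart d a k : ℂ) * cexp (-(τ + θ * I)) ^ k * cexp (n * (τ + θ * I)) =
        QPart d a k * cexp (((n - k : ℤ) : ℂ) * (τ + θ * I)) := by
    intro k θ
    rw [← Complex.exp_nat_mul, mul_assoc, ← Complex.exp_add]
    congr 2
    push_cast
    ring
  have h := intervalIntegral.hasSum_integral_of_dominated_convergence (μ := volume) (a := -π)
    (b := π) (F := fun k θ ↦ (QPart d a k : ℂ) * cexp (-(τ + θ * I)) ^ k * cexp (n * (τ + θ * I)))
    (f := fun θ ↦ QGen d a (cexp (-(τ + θ * I))) * cexp (n * (τ + θ * I)))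
    (fun k _ ↦ (QPart d a k : ℝ) * rexp (-τ) ^ k * rexp (n * τ))
    (fun k ↦ Continuous.aestronglyMeasurable (by fun_prop))
    (fun k ↦ Eventually.of_forall fun θ _ ↦ ?_)
    (Eventually.of_forall fun θ _ ↦ hsum) intervalIntegrable_const
    (Eventually.of_forall fun θ _ ↦ ?_)
  · refine h.unique ?_
    simp_rw [hterm, intervalIntegral.integral_const_mul, integral_exp_int_mul_add_mul_I]
    have hite : (fun k : ℕ ↦ (QPart d a k : ℂ) * if (n - k : ℤ) = 0 then 2 * (π : ℂ) else 0) =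
        fun k ↦ if k = n then (2 * π * QPart d a n : ℂ) else 0 := by
      funext k
      by_cases hk : k = n
      · simp [hk, mul_comm]
      · rw [if_neg hk, if_neg (by lia), mul_zero]
    rw [hite]
    exact hasSum_ite_eq n _
  · rw [norm_mul, norm_mul, norm_pow, norm_exp_neg_add_mul_I, Complex.norm_natCast, norm_exp]
    simp
  · refine HasSum.mul_right _ (Summable.hasSum (Summable.of_norm ?_))
    exact summable_norm_QPart_mul_pow ha ham
      (by rw [norm_exp_neg_add_mul_I]; exact hr1)

theorem tendsto_QPart {d a : ℕ} (ha : 0 < a) (ham : 2 * a < d + 3)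
    (hco : (d + 3 - 2 * a).Coprime (d + 3)) {A : ℝ} (hA : A = π ^ 2 / (3 * (d + 3))) :
    Tendsto (fun n : ℕ ↦ √√(A * n) * √(A * n) / A * (QPart d a n * rexp (-2 * √(A * n)))) atTop
      (𝓝 (1 / (4 * √π * Real.sin (π * a / (d + 3))))) := by
  have hA0 : 0 < A := by rw [hA]; positivity
  obtain ⟨δ, C, hδ, hminor⟩ := exists_norm_QGen_minorArc_le ha ham hco
  have hcusp := tendsto_QGen ha ham
  rw [← hA] at hminor hcusp
  have h := tendsto_circle_integral (F := fun t ↦ QGen d a (cexp (-t))) hA0 hδ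
    (fun τ hτ ↦ continuous_QGen_exp ha ham hτ) hcusp hminor
  have hN : Tendsto (fun n : ℕ ↦ √(A * n)) atTop atTop :=
    Real.tendsto_sqrt_atTop.comp (tendsto_natCast_atTop_atTop.const_mul_atTop hA0)
  have h2 := ((continuous_re.tendsto _).comp (h.comp hN)).div_const (2 * π)
  rw [← ofReal_mul, ofReal_re] at h2
  have hval : √π * (1 / (2 * Real.sin (π * a / (d + 3)))) / (2 * π) =
      1 / (4 * √π * Real.sin (π * a / (d + 3))) := by
    nth_rw 3 [← Real.mul_self_sqrt Real.pi_pos.le]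
    have := (Real.sqrt_pos.mpr Real.pi_pos).ne'
    field_simp
    norm_num
  rw [hval] at h2
  refine h2.congr' ?_
  filter_upwards [eventually_gt_atTop 0] with n hn
  have hn' : (0 : ℝ) < n := by exact_mod_cast hn
  have hpos : 0 < √(A * n) := Real.sqrt_pos.mpr (by positivity)
  have hsq : √(A * n) ^ 2 / A = n := by
    rw [Real.sq_sqrt (by positivity), mul_div_cancel_left₀ _ hA0.ne']
  simp only [Function.comp_apply]
  rw [hsq]
  have hintegral : ∀ θ : ℝ, QGen d a (cexp (-((A / √(A * n) : ℝ) + θ * I))) *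
      cexp ((n : ℝ) * ((A / √(A * n) : ℝ) + θ * I) - 2 * √(A * n)) =
      QGen d a (cexp (-((A / √(A * n) : ℝ) + θ * I))) *
        cexp (n * ((A / √(A * n) : ℝ) + θ * I)) * (rexp (-2 * √(A * n)) : ℝ) := by
    intro θ
    rw [mul_assoc, ofReal_exp, ← Complex.exp_add]
    congr 2
    push_cast
    ring
  simp_rw [hintegral]
  rw [intervalIntegral.integral_mul_const, integral_QGen_mul_exp ha ham (by positivity)]
  rw [show ∀ x y : ℝ, (x : ℂ) * (2 * π * QPart d a n * (y : ℂ)) =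
    ((x * (2 * π * QPart d a n * y) : ℝ) : ℂ) by intros; push_cast; rfl, ofReal_re]
  field_simp

end Coefficients

/-- For every even d ≥ 4, Q_d^{(2)}(n) is asymptotic to
(1/(4(3(d+3))^{1/4} sin(2π/(d+3)))) n^{-3/4} exp(2π√n/√(3(d+3))) as n → ∞. -/
theorem QPart_asymptotic (d : ℕ) (hd : 4 ≤ d) (hde : Even d) :
    Tendsto (fun n : ℕ =>
      (QPart d 2 n : ℝ) /
        (1 / (4 * (3 * ((d : ℝ) + 3)) ^ ((1 : ℝ) / 4) * Real.sin (2 * π / ((d : ℝ) + 3))) *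
          (n : ℝ) ^ (-(3 : ℝ) / 4) *
          Real.exp (2 * π * Real.sqrt n / Real.sqrt (3 * ((d : ℝ) + 3)))))
      atTop (nhds 1) := by
  have hco : (d + 3 - 2 * 2).Coprime (d + 3) := by
    have h4 : (d + 3).Coprime (2 ^ 2) :=
      Nat.Coprime.pow_right 2 (Nat.coprime_two_right.mpr (by grind))
    have h : (d + 3 - 4 + 4).Coprime 4 := by rwa [show d + 3 - 4 + 4 = d + 3 by lia]
    have h' : (d + 3 - 4).Coprime (4 + (d + 3 - 4)) :=
      Nat.coprime_add_self_right.mpr ((Nat.coprime_add_self_left).mp h)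
    rwa [show 4 + (d + 3 - 4) = d + 3 by lia] at h'
  have hm : (0 : ℝ) < 3 * (d + 3) := by positivity
  have hsin : 0 < Real.sin (2 * π / (d + 3)) := by
    have : (4 : ℝ) ≤ d := by exact_mod_cast hd
    refine Real.sin_pos_of_pos_of_lt_pi (by positivity) ?_
    rw [div_lt_iff₀ (by positivity)]
    nlinarith [Real.pi_pos]
  set m : ℝ := 3 * (d + 3)
  set S := Real.sin (2 * π / (d + 3))
  have h := tendsto_QPart (d := d) (a := 2) two_pos (by lia) hco rfl
  rw [show π * (2 : ℕ) / (d + 3) = 2 * π / (d + 3) by push_cast; ring] at h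
  have hS : 4 * √π * S ≠ 0 := by positivity
  have h1 := h.const_mul (4 * √π * S)
  rw [mul_one_div_cancel hS] at h1
  refine h1.congr' ?_
  filter_upwards [eventually_gt_atTop 0] with n hn
  have hn' : (0 : ℝ) < n := by exact_mod_cast hn
  have hsqrt : √(π ^ 2 / m * n) = π * √n / √m := by
    rw [div_mul_eq_mul_div, Real.sqrt_div' _ hm.le, Real.sqrt_mul (sq_nonneg π),
      Real.sqrt_sq Real.pi_pos.le]
  have hn34 : (n : ℝ) ^ (-(3 : ℝ) / 4) = (√√n * √n)⁻¹ := by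
    rw [neg_div, Real.rpow_neg hn'.le, Real.sqrt_eq_rpow, Real.sqrt_eq_rpow,
      ← Real.rpow_mul hn'.le, ← Real.rpow_add hn']
    norm_num
  have hm4 : m ^ ((1 : ℝ) / 4) = √√m := by
    rw [Real.sqrt_eq_rpow, Real.sqrt_eq_rpow, ← Real.rpow_mul hm.le]
    norm_num
  have hexp : rexp (-2 * (π * √n / √m)) = (rexp (2 * π * √n / √m))⁻¹ := by
    rw [← Real.exp_neg]
    ring_nf
  have hm2 : m = √√m ^ 4 := by
    rw [show √√m ^ 4 = (√√m ^ 2) ^ 2 by ring, Real.sq_sqrt (Real.sqrt_nonneg m),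
      Real.sq_sqrt hm.le]
  have hm1 : √m = √√m ^ 2 := (Real.sq_sqrt (Real.sqrt_nonneg m)).symm
  have hpi : π = √π ^ 2 := (Real.sq_sqrt Real.pi_pos.le).symm
  have h4 : √(π * √n / √m) = √π * √√n / √√m := by
    rw [Real.sqrt_div' _ (Real.sqrt_nonneg m), Real.sqrt_mul Real.pi_pos.le]
  have hE := (Real.exp_pos (2 * π * √n / √m)).ne'
  rw [hsqrt, h4, hexp, hn34, hm4]
  generalize rexp (2 * π * √n / √m) = E at hE ⊢
  have hp0 : 0 < √π := Real.sqrt_pos.mpr Real.pi_pos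
  have hw0 : 0 < √√m := Real.sqrt_pos.mpr (Real.sqrt_pos.mpr hm)
  have hq0 : 0 < √√n := Real.sqrt_pos.mpr (Real.sqrt_pos.mpr hn')
  have hv0 : 0 < √(n : ℝ) := Real.sqrt_pos.mpr hn'
  generalize √√(n : ℝ) = u at hq0 ⊢
  generalize √(n : ℝ) = v at hv0 ⊢
  have key : ∀ p w k q s x : ℝ, 0 < p → 0 < w → k = w ^ 4 → q = p ^ 2 → s = w ^ 2 →
      4 * p * S * (p * u / w * (q * v / s) / (q ^ 2 / k) * (x * E⁻¹)) =
        x / (1 / (4 * w * S) * (u * v)⁻¹ * E) := by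
    rintro p w k q s x hp hw rfl rfl rfl
    field_simp
  exact key _ _ _ _ _ _ hp0 hw0 hm2 hpi hm1
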